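/- Let Δ be a stackable triangulation of M_T with linear extension σ₁ < σ₂ < ... < σ_l of the stacking order. Then there is a sequence of polygon triangulations T₀, T₁, ..., T_l with T₀ = T + 1, T_i obtained from T_{i−1} by the increasing flip given by σ_i (replacing the lower facets of σ_i by its upper facets), and T_l = T. -/

import Mathlib

namespace CyclicTri

variable {m : ℕ}

/-- Position of `v` relative to base point `a` in the cyclic order on `ZMod m`. -/
def pos (a v : ZMod m) : ℕ := (v - a).val

/-- `a ≺ b ≺ c` in the cyclic order. -/
def Cyc3 (a b c : ZMod m) : Prop := 0 < pos a b ∧ pos a b < pos a c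

/-- `a ≺ b ≺ c ≺ d` in the cyclic order. -/
def Cyc4 (a b c d : ZMod m) : Prop :=
  0 < pos a b ∧ pos a b < pos a c ∧ pos a c < pos a d

/-- The arcs `xy` and `x'y'` cross: their endpoints interleave cyclically. -/
def Cross (x y x' y' : ZMod m) : Prop := Cyc4 x x' y y' ∨ Cyc4 x' x y' y

/-- `xy` is a diagonal of the polygon: the endpoints are distinct and non-adjacent. -/
def Diag (x y : ZMod m) : Prop := x ≠ y ∧ y ≠ x + 1 ∧ x ≠ y + 1

/-- `A` is (the symmetrised set of arcs of) a triangulation of the convex `m`-gon: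
a maximal set of pairwise non-crossing diagonals. -/
def IsTriangulation (A : Set (ZMod m × ZMod m)) : Prop :=
  (∀ x y, (x, y) ∈ A → (y, x) ∈ A) ∧
  (∀ x y, (x, y) ∈ A → Diag x y) ∧
  (∀ x y x' y', (x, y) ∈ A → (x', y') ∈ A → ¬ Cross x y x' y') ∧
  (∀ x y, Diag x y → (∀ x' y', (x', y') ∈ A → ¬ Cross x y x' y') → (x, y) ∈ A)

/-- There is an arc `xy` of `A` with `a ≺ b ≼ x ≺ c ≺ d ≼ y` (the `+1` case of `χ_T`). -/
def PosCase (A : Set (ZMod m × ZMod m)) (a b c d : ZMod m) : Prop :=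
  ∃ x y, (x, y) ∈ A ∧ 0 < pos a b ∧ pos a b ≤ pos a x ∧ pos a x < pos a c ∧
    pos a c < pos a d ∧ pos a d ≤ pos a y

/-- There is an arc `xy` of `A` with `a ≼ x ≺ b ≺ c ≼ y ≺ d` (the `-1` case of `χ_T`). -/
def NegCase (A : Set (ZMod m × ZMod m)) (a b c d : ZMod m) : Prop :=
  ∃ x y, (x, y) ∈ A ∧ pos a x < pos a b ∧ pos a b < pos a c ∧ pos a c ≤ pos a y ∧
    pos a y < pos a d

open Classical in
/-- The chirotope `χ_T` on cyclically ordered tuples `a ≺ b ≺ c ≺ d`. -/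
noncomputable def chiCyc (A : Set (ZMod m × ZMod m)) (a b c d : ZMod m) : ℤ :=
  if PosCase A a b c d then 1 else if NegCase A a b c d then -1 else 0

end CyclicTri
namespace CyclicTri
variable {m : ℕ}

/-- `a ≺ b ≺ c ≺ d ≺ e` in the cyclic order, for a 5-tuple. -/
def Cyc5 (v : Fin 5 → ZMod m) : Prop :=
  0 < pos (v 0) (v 1) ∧ pos (v 0) (v 1) < pos (v 0) (v 2) ∧
    pos (v 0) (v 2) < pos (v 0) (v 3) ∧ pos (v 0) (v 3) < pos (v 0) (v 4)

/-- The signs of the signed circuit supported on the `5`-subset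
`{v 0, …, v 4}` of the uniform rank-4 oriented matroid with chirotope `chiCyc A`:
the sign of `v i` is `(-1)^i` times the chirotope of the complementary `4`-tuple. -/
noncomputable def circSign (A : Set (ZMod m × ZMod m)) (v : Fin 5 → ZMod m) :
    Fin 5 → ℤ := fun i =>
  if i = 0 then chiCyc A (v 1) (v 2) (v 3) (v 4)
  else if i = 1 then - chiCyc A (v 0) (v 2) (v 3) (v 4)
  else if i = 2 then chiCyc A (v 0) (v 1) (v 3) (v 4)
  else if i = 3 then - chiCyc A (v 0) (v 1) (v 2) (v 4)
  else chiCyc A (v 0) (v 1) (v 2) (v 3)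

end CyclicTri
namespace CyclicTri
variable {m : ℕ}

open Classical in
/-- The alternating extension `χ_T(x, a, b, c)` for `a ≺ b ≺ c` and `x ∉ {a,b,c}`. -/
noncomputable def chiX (A : Set (ZMod m × ZMod m)) (x a b c : ZMod m) : ℤ :=
  if Cyc4 x a b c then chiCyc A x a b c
  else if Cyc4 a x b c then - chiCyc A a x b c
  else chiCyc A a b x c

/-- `xy` is an arc of `B` or a boundary edge of the polygon. -/
def EdgeOf (B : Set (ZMod m × ZMod m)) (x y : ZMod m) : Prop :=
  (x, y) ∈ B ∨ y = x + 1 ∨ x = y + 1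

/-- `abc` is a triangle of the triangulation `A`: all sides are arcs or boundary edges. -/
def IsTriangleOf (A : Set (ZMod m × ZMod m)) (a b c : ZMod m) : Prop :=
  Cyc3 a b c ∧ EdgeOf A a b ∧ EdgeOf A b c ∧ EdgeOf A c a

/-- `{a,b,c}` is a facet of the oriented matroid `M_T`: the complementary cocircuit
has all of its elements of the same sign. -/
def IsFacet (A : Set (ZMod m × ZMod m)) (a b c : ZMod m) : Prop :=
  Cyc3 a b c ∧
    ((∀ x : ZMod m, x ≠ a → x ≠ b → x ≠ c → chiX A x a b c = 1) ∨
     (∀ x : ZMod m, x ≠ a → x ≠ b → x ≠ c → chiX A x a b c = -1))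

end CyclicTri
namespace CyclicTri
variable {m : ℕ}

/-- `F` is an upper facet of the basis (3-simplex) `σ` with respect to `T`. -/
def IsUpperFacetOf (A : Set (ZMod m × ZMod m)) (F σ : Finset (ZMod m)) : Prop :=
  ∃ a b c d : ZMod m, Cyc4 a b c d ∧ σ = {a, b, c, d} ∧
    ((chiCyc A a b c d = 1 ∧ (F = {a, b, d} ∨ F = {b, c, d})) ∨
     (chiCyc A a b c d = -1 ∧ (F = {a, b, c} ∨ F = {a, c, d})))

/-- `F` is a lower facet of the basis (3-simplex) `σ` with respect to `T`. -/
def IsLowerFacetOf (A : Set (ZMod m × ZMod m)) (F σ : Finset (ZMod m)) : Prop :=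
  ∃ a b c d : ZMod m, Cyc4 a b c d ∧ σ = {a, b, c, d} ∧
    ((chiCyc A a b c d = 1 ∧ (F = {a, b, c} ∨ F = {a, c, d})) ∨
     (chiCyc A a b c d = -1 ∧ (F = {a, b, d} ∨ F = {b, c, d})))

/-- `σ` and `τ` overlap on a circuit `C = (C⁺, C⁻)`: `C⁺ ⊆ σ` and there is `a ∈ C⁺`
with `C̲ \ {a} ⊆ τ`.  Circuits of the uniform rank-4 oriented matroid are the
5-subsets, with signs `circSign` up to a global sign `ε`. -/
def Overlap (A : Set (ZMod m × ZMod m)) (σ τ : Finset (ZMod m)) : Prop :=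
  ∃ v : Fin 5 → ZMod m, Cyc5 v ∧ ∃ ε : ℤ, (ε = 1 ∨ ε = -1) ∧
    (∀ i, circSign A v i = ε → v i ∈ σ) ∧
    ∃ j, circSign A v j = ε ∧ ∀ i, i ≠ j → v i ∈ τ

/-- `Δ` is a triangulation of the oriented matroid `M_T` (with arcs `A`):
a nonempty collection of bases (4-subsets) such that each facet of a member is
either a facet of `M_T` or contained in precisely two members, and no two members
overlap on a circuit.  (Intersections being common faces is automatic for the
uniform rank-4 matroid restricted to bases.) -/
def IsMatTriangulation (A : Set (ZMod m × ZMod m)) (Δ : Finset (Finset (ZMod m))) : Prop :=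
  Δ.Nonempty ∧ (∀ σ ∈ Δ, σ.card = 4) ∧
  (∀ σ ∈ Δ, ∀ F ⊆ σ, F.card = 3 →
    (∃ a b c : ZMod m, Cyc3 a b c ∧ F = {a, b, c} ∧ IsFacet A a b c) ∨
    (Δ.filter (fun τ => F ⊆ τ)).card = 2) ∧
  (∀ σ ∈ Δ, ∀ τ ∈ Δ, ¬ Overlap A σ τ)

end CyclicTri

namespace CyclicTri
variable {m : ℕ}

/-- The generating relation `σ ⇝ τ` on a triangulation `Δ` of `M_T`. -/
def StackRelOn (A : Set (ZMod m × ZMod m)) (Δ : Finset (Finset (ZMod m)))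
    (σ τ : Finset (ZMod m)) : Prop :=
  σ ∈ Δ ∧ τ ∈ Δ ∧ (σ ∩ τ).card = 3 ∧
    IsUpperFacetOf A (σ ∩ τ) σ ∧ IsLowerFacetOf A (σ ∩ τ) τ

/-- `xy` is an arc of `B` or a boundary edge. -/
def EdgeIn (B : Set (ZMod m × ZMod m)) (x y : ZMod m) : Prop :=
  (x, y) ∈ B ∨ y = x + 1 ∨ x = y + 1

/-- `next` is obtained from `prev` by the increasing flip given by the simplex `σ`
(with respect to the chirotope of `T`): the quadrilateral of `σ` lies in `prev` with
the diagonal common to the lower facets of `σ`, and that diagonal is replaced by the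
diagonal common to the upper facets. -/
def IncFlip (A : Set (ZMod m × ZMod m)) (σ : Finset (ZMod m))
    (prev next : Set (ZMod m × ZMod m)) : Prop :=
  ∃ a b c d : ZMod m, Cyc4 a b c d ∧ σ = {a, b, c, d} ∧
    EdgeIn prev a b ∧ EdgeIn prev b c ∧ EdgeIn prev c d ∧ EdgeIn prev d a ∧
    ((chiCyc A a b c d = 1 ∧ (a, c) ∈ prev ∧
        next = (prev \ {(a, c), (c, a)}) ∪ {(b, d), (d, b)}) ∨
     (chiCyc A a b c d = -1 ∧ (b, d) ∈ prev ∧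
        next = (prev \ {(b, d), (d, b)}) ∪ {(a, c), (c, a)}))

/-- The rotated triangulation `T + 1`. -/
def shiftOne (A : Set (ZMod m × ZMod m)) : Set (ZMod m × ZMod m) :=
  { p | (p.1 - 1, p.2 - 1) ∈ A }

end CyclicTri


namespace CyclicTri
section Basics
set_option linter.unusedSectionVars false
variable {m : ℕ} [NeZero m]

theorem pos_lt (a v : ZMod m) : pos a v < m := ZMod.val_lt _

theorem pos_self (a : ZMod m) : pos a a = 0 := by simp [pos]

theorem pos_inj {o a b : ZMod m} (h : pos o a = pos o b) : a = b := by
  have := ZMod.val_injective m h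
  simpa using this

theorem pos_base (o a v : ZMod m) :
    (pos o a ≤ pos o v ∧ pos a v + pos o a = pos o v) ∨
    (pos o v < pos o a ∧ pos a v + pos o a = m + pos o v) := by
  have h : pos o v = (pos a v + pos o a) % m := by
    unfold pos
    rw [← ZMod.val_add]; congr 1; ring
  have h1 := pos_lt o a
  have h2 := pos_lt a v
  rcases lt_or_ge (pos a v + pos o a) m with h3 | h3
  · rw [Nat.mod_eq_of_lt h3] at h; omega
  · rw [Nat.mod_eq_sub_mod h3, Nat.mod_eq_of_lt (by omega)] at h; omega

theorem pos_succ (hm : 4 ≤ m) (o v : ZMod m) :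
    (pos o v + 1 < m ∧ pos o (v + 1) = pos o v + 1) ∨
    (pos o v + 1 = m ∧ pos o (v + 1) = 0) := by
  have h1 : pos v (v + 1) = 1 := by
    unfold pos
    simp only [add_sub_cancel_left]
    have : Fact (1 < m) := ⟨by omega⟩
    exact ZMod.val_one m
  have := pos_base o v (v + 1)
  have := pos_lt o v
  have := pos_lt o (v + 1)
  omega

theorem pos_pred (hm : 4 ≤ m) (o v : ZMod m) :
    (0 < pos o v ∧ pos o (v - 1) + 1 = pos o v) ∨
    (pos o v = 0 ∧ pos o (v - 1) + 1 = m) := by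
  have := pos_succ hm o (v - 1)
  rw [sub_add_cancel] at this
  omega

theorem succ_iff (hm : 4 ≤ m) (o x y : ZMod m) :
    y = x + 1 ↔ (pos o y = pos o x + 1 ∨ (pos o x + 1 = m ∧ pos o y = 0)) := by
  have h := pos_succ hm o x
  have := pos_lt o y
  constructor
  · rintro rfl; omega
  · intro h'; apply pos_inj (o := o); omega

theorem eq_iff (o x y : ZMod m) : x = y ↔ pos o x = pos o y :=
  ⟨fun h => by rw [h], pos_inj⟩

theorem cyc4_iff (o a b c d : ZMod m) : Cyc4 a b c d ↔
    (pos o a < pos o b ∧ pos o b < pos o c ∧ pos o c < pos o d) ∨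
    (pos o b < pos o c ∧ pos o c < pos o d ∧ pos o d < pos o a) ∨
    (pos o c < pos o d ∧ pos o d < pos o a ∧ pos o a < pos o b) ∨
    (pos o d < pos o a ∧ pos o a < pos o b ∧ pos o b < pos o c) := by
  unfold Cyc4
  have := pos_base o a b
  have := pos_base o a c
  have := pos_base o a d
  have := pos_lt o a
  have := pos_lt o b
  have := pos_lt o c
  have := pos_lt o d
  omega

theorem cyc3_iff (o a b c : ZMod m) : Cyc3 a b c ↔
    (pos o a < pos o b ∧ pos o b < pos o c) ∨
    (pos o b < pos o c ∧ pos o c < pos o a) ∨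
    (pos o c < pos o a ∧ pos o a < pos o b) := by
  unfold Cyc3
  have := pos_base o a b
  have := pos_base o a c
  have := pos_lt o a
  have := pos_lt o b
  have := pos_lt o c
  omega

theorem diag_iff (hm : 4 ≤ m) (o x y : ZMod m) : Diag x y ↔
    (pos o x ≠ pos o y ∧ ¬ (pos o y = pos o x + 1 ∨ (pos o x + 1 = m ∧ pos o y = 0)) ∧
      ¬ (pos o x = pos o y + 1 ∨ (pos o y + 1 = m ∧ pos o x = 0))) := by
  unfold Diag
  rw [ne_eq, ne_eq, ne_eq, succ_iff hm o x y, succ_iff hm o y x, eq_iff o x y]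

theorem cyc4_rot {a b c d : ZMod m} (h : Cyc4 a b c d) : Cyc4 b c d a := by
  rw [cyc4_iff a] at h ⊢; omega

theorem pos_iff {A : Set (ZMod m × ZMod m)} {a b c d : ZMod m} (h : Cyc4 a b c d) :
    PosCase A a b c d ↔ ∃ x y, (x, y) ∈ A ∧
      (x = b ∨ Cyc4 b x c d) ∧ (y = d ∨ Cyc4 d y a b) := by
  unfold PosCase
  refine exists_congr fun x => exists_congr fun y => and_congr_right fun _ => ?_
  rw [cyc4_iff a, cyc4_iff a, eq_iff a x, eq_iff a y] at *
  have := pos_self a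
  have := pos_lt a x
  have := pos_lt a y
  omega

theorem neg_iff {A : Set (ZMod m × ZMod m)} {a b c d : ZMod m} (h : Cyc4 a b c d) :
    NegCase A a b c d ↔ ∃ x y, (x, y) ∈ A ∧
      (x = a ∨ Cyc4 a x b c) ∧ (y = c ∨ Cyc4 c y d a) := by
  unfold NegCase
  refine exists_congr fun x => exists_congr fun y => and_congr_right fun _ => ?_
  rw [cyc4_iff a, cyc4_iff a, eq_iff a x, eq_iff a y] at *
  have := pos_self a
  have := pos_lt a x
  have := pos_lt a y
  omega

theorem cross_symm_left {x y x' y' : ZMod m} (h : Cross x y x' y') : Cross y x x' y' := by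
  rcases h with h | h
  · exact Or.inr (cyc4_rot h)
  · exact Or.inl (cyc4_rot (cyc4_rot (cyc4_rot h)))

theorem cross_comm {x y x' y' : ZMod m} (h : Cross x y x' y') : Cross x' y' x y := by
  rcases h with h | h
  · exact Or.inr h
  · exact Or.inl h

theorem cross_symm_right {x y x' y' : ZMod m} (h : Cross x y x' y') : Cross x y y' x' :=
  cross_comm (cross_symm_left (cross_comm h))

theorem cross_cases (o : ZMod m) {x y p q : ZMod m} (h : Cross x y p q)
    (hxy : pos o x < pos o y) :
    (pos o x < pos o p ∧ pos o p < pos o y ∧ (pos o q < pos o x ∨ pos o y < pos o q)) ∨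
    (pos o x < pos o q ∧ pos o q < pos o y ∧ (pos o p < pos o x ∨ pos o y < pos o p)) := by
  rcases h with h | h
  · rw [cyc4_iff o] at h; omega
  · rw [cyc4_iff o] at h; omega

theorem cross_mk (o : ZMod m) {x y p q : ZMod m}
    (h1 : pos o x < pos o p) (h2 : pos o p < pos o y)
    (h3 : pos o q < pos o x ∨ pos o y < pos o q) : Cross x y p q := by
  left
  rw [cyc4_iff o]; omega

theorem succ_noncross (hm : 4 ≤ m) {x x' y' : ZMod m} : ¬ Cross x (x + 1) x' y' := by
  intro h
  have h0 := pos_self x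
  have h1 := pos_succ hm x x
  have := cross_cases x h (by omega)
  omega

/-- boundary edges cross nothing -/
theorem edge_noncross (hm : 4 ≤ m) {B : Set (ZMod m × ZMod m)} (hB : IsTriangulation B)
    {x y x' y' : ZMod m} (h : EdgeOf B x y) (h' : EdgeOf B x' y') : ¬ Cross x y x' y' := by
  intro hc
  rcases h with h | h | h
  · rcases h' with h' | h' | h'
    · exact hB.2.2.1 _ _ _ _ h h' hc
    · subst h'; exact succ_noncross hm (cross_comm hc)
    · subst h'; exact succ_noncross hm (cross_comm (cross_symm_right hc))
  · subst h; exact succ_noncross hm hc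
  · subst h; exact succ_noncross hm (cross_symm_left hc)

theorem edge_symm {B : Set (ZMod m × ZMod m)} (hB : IsTriangulation B)
    {x y : ZMod m} (h : EdgeOf B x y) : EdgeOf B y x := by
  rcases h with h | h | h
  · exact Or.inl (hB.1 _ _ h)
  · exact Or.inr (Or.inr h)
  · exact Or.inr (Or.inl h)

theorem edge_of_noncross {B : Set (ZMod m × ZMod m)} (hB : IsTriangulation B)
    {x y : ZMod m} (hne : x ≠ y) (h : ∀ x' y', (x', y') ∈ B → ¬ Cross x y x' y') :
    EdgeOf B x y := by
  by_cases h1 : y = x + 1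
  · exact Or.inr (Or.inl h1)
  by_cases h2 : x = y + 1
  · exact Or.inr (Or.inr h2)
  exact Or.inl (hB.2.2.2 _ _ ⟨hne, h1, h2⟩ h)

theorem mem_of_edge (hm : 4 ≤ m) {B : Set (ZMod m × ZMod m)} {a b c d : ZMod m}
    (hc : Cyc4 a b c d) (h : EdgeOf B a c) : (a, c) ∈ B := by
  rcases h with h | h | h
  · exact h
  all_goals
    exfalso
    rw [succ_iff hm a] at h
    rw [cyc4_iff a] at hc
    have := pos_self a
    have := pos_lt a d
    have := pos_lt a c
    omega

/-- Existence of a triangle on the side `(x, y)` of an edge. -/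
theorem exists_apex (hm : 4 ≤ m) {B : Set (ZMod m × ZMod m)} (hB : IsTriangulation B)
    {x y : ZMod m} (h : EdgeOf B x y) (h2 : 2 ≤ pos x y) :
    ∃ z, 0 < pos x z ∧ pos x z < pos x y ∧ EdgeOf B x z ∧ EdgeOf B z y := by
  classical
  have hx0 := pos_self x
  have hne : ((Finset.univ : Finset (ZMod m)).filter
      (fun z => 0 < pos x z ∧ pos x z < pos x y ∧ EdgeOf B x z)).Nonempty := by
    refine ⟨x + 1, ?_⟩
    have := pos_succ hm x x
    simp only [Finset.mem_filter, Finset.mem_univ, true_and]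
    exact ⟨by omega, by omega, Or.inr (Or.inl rfl)⟩
  obtain ⟨z, hz, hmax⟩ := Finset.exists_max_image _ (pos x) hne
  simp only [Finset.mem_filter, Finset.mem_univ, true_and] at hz hmax
  refine ⟨z, hz.1, hz.2.1, hz.2.2, ?_⟩
  apply edge_of_noncross hB
  · intro h; rw [h] at hz; omega
  have key : ∀ p q, (p, q) ∈ B → pos x z < pos x p → pos x p < pos x y →
      (pos x q < pos x z ∨ pos x y < pos x q) → False := by
    intro p q hpq h3 h4 h5
    have n1 := edge_noncross hm hB h (Or.inl hpq)
    have n2 := edge_noncross hm hB hz.2.2 (Or.inl hpq)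
    have n3 : ¬ pos x y < pos x q := fun hh => n1 (Or.inl ⟨by omega, h4, hh⟩)
    have n4 : ¬ 0 < pos x q := fun hh => n2 (cross_symm_right (Or.inl ⟨hh, by omega, h3⟩))
    have hq : pos x q = pos x x := by omega
    have := pos_inj hq
    subst this
    have := hmax p ⟨by omega, h4, Or.inl (hB.1 _ _ hpq)⟩
    omega
  intro p q hpq hc
  rcases cross_cases x hc hz.2.1 with hc | hc
  · exact key p q hpq hc.1 hc.2.1 hc.2.2
  · exact key q p (hB.1 _ _ hpq) hc.1 hc.2.1 hc.2.2

theorem not_pos_neg {A : Set (ZMod m × ZMod m)} (hA : IsTriangulation A) {a b c d : ZMod m}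
    (h1 : PosCase A a b c d) (h2 : NegCase A a b c d) : False := by
  obtain ⟨x, y, hxy, h⟩ := h1
  obtain ⟨x', y', hxy', h'⟩ := h2
  exact hA.2.2.1 _ _ _ _ hxy hxy' (cross_symm_right
    (cross_mk a (by omega) (by omega) (by omega)))

theorem pos_rot {A : Set (ZMod m × ZMod m)} (hA : IsTriangulation A) {a b c d : ZMod m}
    (h : Cyc4 a b c d) : PosCase A b c d a ↔ NegCase A a b c d := by
  rw [pos_iff (cyc4_rot h), neg_iff h]
  constructor
  · rintro ⟨x, y, h1, h2, h3⟩
    exact ⟨y, x, hA.1 _ _ h1, h3, h2⟩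
  · rintro ⟨x, y, h1, h2, h3⟩
    exact ⟨y, x, hA.1 _ _ h1, h3, h2⟩

theorem neg_rot {A : Set (ZMod m × ZMod m)} {a b c d : ZMod m}
    (h : Cyc4 a b c d) : NegCase A b c d a ↔ PosCase A a b c d := by
  rw [pos_iff h, neg_iff (cyc4_rot h)]

theorem pos_or_neg (hm : 4 ≤ m) {A : Set (ZMod m × ZMod m)} (hA : IsTriangulation A)
    {a b c d : ZMod m} (h : Cyc4 a b c d) : PosCase A a b c d ∨ NegCase A a b c d := by
  classical
  have h4 := h
  unfold Cyc4 at h4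
  have ha := pos_self a
  let S := (Finset.univ : Finset (ZMod m × ZMod m)).filter (fun p =>
    pos a p.1 < pos a b ∧ pos a b ≤ pos a p.2 ∧ pos a p.2 < pos a c ∧ EdgeOf A p.1 p.2)
  have hne : S.Nonempty := by
    refine ⟨(b - 1, b), ?_⟩
    simp only [S, Finset.mem_filter, Finset.mem_univ, true_and]
    have := pos_pred hm a b
    exact ⟨by omega, le_refl _, by omega, Or.inr (Or.inl (by ring))⟩
  obtain ⟨⟨x, y⟩, hp, hmax⟩ := Finset.exists_max_image S
    (fun p => pos a p.2 + m - pos a p.1) hne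
  simp only [S, Finset.mem_filter, Finset.mem_univ, true_and, Prod.forall] at hp hmax
  obtain ⟨h1, h2, h3, h5⟩ := hp
  have hd := pos_lt a d
  have b1 := pos_base a y x
  obtain ⟨z, hz1, hz2, hz3, hz4⟩ := exists_apex hm hA (edge_symm hA h5) (by omega)
  have b2 := pos_base a y z
  have hzm := pos_lt a z
  have m1 := hmax z y
  have m2 := hmax x z
  have e1 : ¬ (pos a z < pos a x) := fun hh => by
    have := m1 ⟨by omega, h2, h3, edge_symm hA hz3⟩
    omega
  have e2 : ¬ (pos a y < pos a z ∧ pos a z < pos a c) := fun hh => by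
    have := m2 ⟨h1, by omega, hh.2, edge_symm hA hz4⟩
    omega
  rcases lt_or_ge (pos a z) (pos a d) with hzd | hzd
  · right
    refine ⟨x, z, ?_, by omega, by omega, by omega, hzd⟩
    apply mem_of_edge hm (b := y) (d := d) _ (edge_symm hA hz4)
    rw [cyc4_iff a]; omega
  · left
    refine ⟨y, z, ?_, by omega, by omega, by omega, by omega, hzd⟩
    apply mem_of_edge hm (b := c) (d := x) _ hz3
    rw [cyc4_iff a]
    have : x ≠ z := by rintro rfl; omega
    rw [ne_eq, eq_iff a] at this
    omega

theorem chi_one {A : Set (ZMod m × ZMod m)} {a b c d : ZMod m} :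
    chiCyc A a b c d = 1 ↔ PosCase A a b c d := by
  unfold chiCyc; split_ifs <;> simp_all

theorem chi_neg {A : Set (ZMod m × ZMod m)} (hA : IsTriangulation A) {a b c d : ZMod m} :
    chiCyc A a b c d = -1 ↔ NegCase A a b c d := by
  have := @not_pos_neg m _ A hA a b c d
  unfold chiCyc; split_ifs <;> simp_all

end Basics
end CyclicTri

namespace CyclicTri
section Facets
set_option linter.unusedSectionVars false
variable {m : ℕ} [NeZero m]

/-- `x` is on the upper side of `F`. -/
def Up (A : Set (ZMod m × ZMod m)) (F : Finset (ZMod m)) (x : ZMod m) : Prop :=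
  ∃ a b c, F = {a, b, c} ∧ Cyc4 x a b c ∧ PosCase A x a b c

/-- `x` is on the lower side of `F`. -/
def Dn (A : Set (ZMod m × ZMod m)) (F : Finset (ZMod m)) (x : ZMod m) : Prop :=
  ∃ a b c, F = {a, b, c} ∧ Cyc4 x a b c ∧ NegCase A x a b c

/-- `F` is a triangle of `B`. -/
def Tri (B : Set (ZMod m × ZMod m)) (F : Finset (ZMod m)) : Prop :=
  F.card = 3 ∧ ∀ x ∈ F, ∀ y ∈ F, x ≠ y → EdgeOf B x y

theorem set3_rot (a b c : ZMod m) : ({b, c, a} : Finset (ZMod m)) = {a, b, c} := by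
  ext; simp; tauto

theorem set3_rot2 (a b c : ZMod m) : ({c, a, b} : Finset (ZMod m)) = {a, b, c} := by
  ext; simp; tauto

theorem sort_unique {x a b c a' b' c' : ZMod m} (h : Cyc4 x a b c) (h' : Cyc4 x a' b' c')
    (e : ({a, b, c} : Finset (ZMod m)) = {a', b', c'}) : a = a' ∧ b = b' ∧ c = c' := by
  have ha : a ∈ ({a', b', c'} : Finset (ZMod m)) := by rw [← e]; simp
  have hb : b ∈ ({a', b', c'} : Finset (ZMod m)) := by rw [← e]; simp
  have hc : c ∈ ({a', b', c'} : Finset (ZMod m)) := by rw [← e]; simp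
  simp only [Finset.mem_insert, Finset.mem_singleton, eq_iff x] at ha hb hc
  unfold Cyc4 at h h'
  simp only [eq_iff x]
  omega

theorem not_up_dn {A : Set (ZMod m × ZMod m)} (hA : IsTriangulation A) {F : Finset (ZMod m)}
    {x : ZMod m} (h : Up A F x) (h' : Dn A F x) : False := by
  obtain ⟨a, b, c, rfl, h1, h2⟩ := h
  obtain ⟨a', b', c', e, h1', h2'⟩ := h'
  obtain ⟨rfl, rfl, rfl⟩ := sort_unique h1 h1' e
  exact not_pos_neg hA h2 h2'

theorem cyc4_ne {a b c d : ZMod m} (h : Cyc4 a b c d) :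
    a ≠ b ∧ a ≠ c ∧ a ≠ d ∧ b ≠ c ∧ b ≠ d ∧ c ≠ d := by
  simp only [ne_eq, eq_iff a]
  have := pos_self a
  unfold Cyc4 at h
  omega

theorem exists_sort3 {x : ZMod m} {F : Finset (ZMod m)} (hx : x ∉ F) (hF : F.card = 3) :
    ∃ a b c, F = {a, b, c} ∧ Cyc4 x a b c := by
  obtain ⟨a, b, c, hab, hac, hbc, rfl⟩ := Finset.card_eq_three.mp hF
  simp only [Finset.mem_insert, Finset.mem_singleton, not_or] at hx
  have hx' := hx
  have h0 := pos_self x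
  rw [eq_iff x, eq_iff x, eq_iff x] at hx'
  rw [ne_eq, eq_iff x] at hab hac hbc
  have p1 : ({a, c, b} : Finset (ZMod m)) = {a, b, c} := by ext; simp; tauto
  have p2 : ({b, a, c} : Finset (ZMod m)) = {a, b, c} := by ext; simp; tauto
  have p3 : ({b, c, a} : Finset (ZMod m)) = {a, b, c} := by ext; simp; tauto
  have p4 : ({c, a, b} : Finset (ZMod m)) = {a, b, c} := by ext; simp; tauto
  have p5 : ({c, b, a} : Finset (ZMod m)) = {a, b, c} := by ext; simp; tauto
  unfold Cyc4
  rcases lt_or_ge (pos x a) (pos x b) with h1 | h1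
  · rcases lt_or_ge (pos x b) (pos x c) with h2 | h2
    · exact ⟨a, b, c, rfl, by omega⟩
    · rcases lt_or_ge (pos x a) (pos x c) with h3 | h3
      · exact ⟨a, c, b, p1.symm, by omega⟩
      · exact ⟨c, a, b, p4.symm, by omega⟩
  · rcases lt_or_ge (pos x a) (pos x c) with h2 | h2
    · exact ⟨b, a, c, p2.symm, by omega⟩
    · rcases lt_or_ge (pos x b) (pos x c) with h3 | h3
      · exact ⟨b, c, a, p3.symm, by omega⟩
      · exact ⟨c, b, a, p5.symm, by omega⟩

theorem up_or_dn (hm : 4 ≤ m) {A : Set (ZMod m × ZMod m)} (hA : IsTriangulation A)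
    {F : Finset (ZMod m)} {x : ZMod m} (hx : x ∉ F) (hF : F.card = 3) : Up A F x ∨ Dn A F x := by
  obtain ⟨a, b, c, h1, h2⟩ := exists_sort3 hx hF
  rcases pos_or_neg hm hA h2 with h | h
  · exact Or.inl ⟨a, b, c, h1, h2, h⟩
  · exact Or.inr ⟨a, b, c, h1, h2, h⟩

theorem card_of_cyc4 {x a b c : ZMod m} (h : Cyc4 x a b c) :
    x ∉ ({a, b, c} : Finset (ZMod m)) ∧ ({a, b, c} : Finset (ZMod m)).card = 3 := by
  obtain ⟨h1, h2, h3, h4, h5, h6⟩ := cyc4_ne h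
  refine ⟨by simp [h1, h2, h3], Finset.card_eq_three.mpr ⟨a, b, c, h4, h5, h6, rfl⟩⟩

theorem up_card {A : Set (ZMod m × ZMod m)} {F : Finset (ZMod m)} {x : ZMod m}
    (h : Up A F x) : x ∉ F ∧ F.card = 3 := by
  obtain ⟨a, b, c, rfl, h, -⟩ := h
  exact card_of_cyc4 h

theorem dn_card {A : Set (ZMod m × ZMod m)} {F : Finset (ZMod m)} {x : ZMod m}
    (h : Dn A F x) : x ∉ F ∧ F.card = 3 := by
  obtain ⟨a, b, c, rfl, h, -⟩ := h
  exact card_of_cyc4 h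

/-- sides of the four facets of a simplex -/
theorem sides {A : Set (ZMod m × ZMod m)} (hA : IsTriangulation A) {a b c d : ZMod m}
    (h : Cyc4 a b c d) (hp : PosCase A a b c d) :
    Up A {b, c, d} a ∧ Dn A {a, c, d} b ∧ Up A {a, b, d} c ∧ Dn A {a, b, c} d := by
  have r1 := cyc4_rot h
  have r2 := cyc4_rot r1
  have r3 := cyc4_rot r2
  have n1 : NegCase A b c d a := (neg_rot h).mpr hp
  have n2 : PosCase A c d a b := (pos_rot hA r1).mpr n1
  have n3 : NegCase A d a b c := (neg_rot r2).mpr n2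
  refine ⟨⟨b, c, d, rfl, h, hp⟩, ⟨c, d, a, ?_, r1, n1⟩, ⟨d, a, b, ?_, r2, n2⟩,
    ⟨a, b, c, rfl, r3, n3⟩⟩
  · ext; simp; tauto
  · ext; simp; tauto

theorem upper_iff {A : Set (ZMod m × ZMod m)} (hA : IsTriangulation A)
    {F σ : Finset (ZMod m)} : IsUpperFacetOf A F σ ↔ ∃ x, σ = insert x F ∧ Up A F x := by
  constructor
  · rintro ⟨a, b, c, d, h, rfl, ⟨hc, rfl | rfl⟩ | ⟨hc, rfl | rfl⟩⟩
    · exact ⟨c, by ext; simp; tauto, (sides hA h (chi_one.mp hc)).2.2.1⟩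
    · exact ⟨a, rfl, (sides hA h (chi_one.mp hc)).1⟩
    · have := sides hA (cyc4_rot h) ((pos_rot hA h).mpr ((chi_neg hA).mp hc))
      refine ⟨d, by ext; simp; tauto, ?_⟩
      convert this.2.2.1 using 1; ext; simp; tauto
    · have := sides hA (cyc4_rot h) ((pos_rot hA h).mpr ((chi_neg hA).mp hc))
      refine ⟨b, by ext; simp; tauto, ?_⟩
      convert this.1 using 1; ext; simp; tauto
  · rintro ⟨x, rfl, a, b, c, rfl, h, hp⟩
    exact ⟨x, a, b, c, h, rfl, Or.inl ⟨chi_one.mpr hp, Or.inr rfl⟩⟩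

theorem lower_iff {A : Set (ZMod m × ZMod m)} (hA : IsTriangulation A)
    {F σ : Finset (ZMod m)} : IsLowerFacetOf A F σ ↔ ∃ x, σ = insert x F ∧ Dn A F x := by
  constructor
  · rintro ⟨a, b, c, d, h, rfl, ⟨hc, rfl | rfl⟩ | ⟨hc, rfl | rfl⟩⟩
    · exact ⟨d, by ext; simp; tauto, (sides hA h (chi_one.mp hc)).2.2.2⟩
    · exact ⟨b, by ext; simp; tauto, (sides hA h (chi_one.mp hc)).2.1⟩
    · have := sides hA (cyc4_rot h) ((pos_rot hA h).mpr ((chi_neg hA).mp hc))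
      refine ⟨c, by ext; simp; tauto, ?_⟩
      convert this.2.1 using 1; ext; simp; tauto
    · have := sides hA (cyc4_rot h) ((pos_rot hA h).mpr ((chi_neg hA).mp hc))
      refine ⟨a, by ext; simp, ?_⟩
      convert this.2.2.2 using 1
  · rintro ⟨x, rfl, a, b, c, rfl, h, hp⟩
    exact ⟨x, a, b, c, h, rfl, Or.inr ⟨(chi_neg hA).mpr hp, Or.inr rfl⟩⟩

theorem cyc3_x {a b c x : ZMod m} (h : Cyc3 a b c) (h1 : x ≠ a) (h2 : x ≠ b) (h3 : x ≠ c) :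
    Cyc4 x a b c ∨ Cyc4 a x b c ∨ Cyc4 a b x c := by
  simp only [ne_eq, eq_iff a] at h1 h2 h3
  simp only [cyc4_iff a]
  unfold Cyc3 at h
  have := pos_self a
  omega

theorem chiX_up {A : Set (ZMod m × ZMod m)} (hA : IsTriangulation A) {a b c x : ZMod m}
    (h : Cyc3 a b c) (h1 : x ≠ a) (h2 : x ≠ b) (h3 : x ≠ c) (hp : chiX A x a b c = 1) :
    Up A {a, b, c} x := by
  unfold chiX at hp
  split_ifs at hp with c1 c2
  · exact (sides hA c1 (chi_one.mp hp)).1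
  · have := sides hA (cyc4_rot c2) ((pos_rot hA c2).mpr ((chi_neg hA).mp (by omega)))
    convert this.1 using 1; ext; simp; tauto
  · have c3 : Cyc4 a b x c := by rcases cyc3_x h h1 h2 h3 with h | h | h <;> tauto
    exact (sides hA c3 (chi_one.mp hp)).2.2.1

theorem chiX_dn {A : Set (ZMod m × ZMod m)} (hA : IsTriangulation A) {a b c x : ZMod m}
    (h : Cyc3 a b c) (h1 : x ≠ a) (h2 : x ≠ b) (h3 : x ≠ c) (hp : chiX A x a b c = -1) :
    Dn A {a, b, c} x := by
  unfold chiX at hp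
  split_ifs at hp with c1 c2
  · exact ⟨a, b, c, rfl, c1, (chi_neg hA).mp hp⟩
  · exact (sides hA c2 (chi_one.mp (by omega))).2.1
  · have c3 : Cyc4 a b x c := by rcases cyc3_x h h1 h2 h3 with h | h | h <;> tauto
    have := sides hA (cyc4_rot c3) ((pos_rot hA c3).mpr ((chi_neg hA).mp hp))
    convert this.2.1 using 1; ext; simp; tauto

theorem facet_cases {A : Set (ZMod m × ZMod m)} (hA : IsTriangulation A) {a b c : ZMod m}
    (h : IsFacet A a b c) :
    (∀ x ∉ ({a, b, c} : Finset (ZMod m)), Up A {a, b, c} x) ∨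
    (∀ x ∉ ({a, b, c} : Finset (ZMod m)), Dn A {a, b, c} x) := by
  rcases h with ⟨h, h' | h'⟩
  · left
    intro x hx
    simp only [Finset.mem_insert, Finset.mem_singleton, not_or] at hx
    exact chiX_up hA h hx.1 hx.2.1 hx.2.2 (h' x hx.1 hx.2.1 hx.2.2)
  · right
    intro x hx
    simp only [Finset.mem_insert, Finset.mem_singleton, not_or] at hx
    exact chiX_dn hA h hx.1 hx.2.1 hx.2.2 (h' x hx.1 hx.2.1 hx.2.2)

theorem cyc3_rot {a b c : ZMod m} (h : Cyc3 a b c) : Cyc3 b c a := by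
  rw [cyc3_iff a] at h ⊢; omega

set_option maxHeartbeats 2000000 in
theorem up_edge (hm : 4 ≤ m) {A : Set (ZMod m × ZMod m)} (hA : IsTriangulation A)
    {a b c : ZMod m} (h : Cyc3 a b c)
    (hu : ∀ x ∉ ({a, b, c} : Finset (ZMod m)), Up A {a, b, c} x) : EdgeOf A c a := by
  have ha := pos_self a
  have h' := h
  unfold Cyc3 at h'
  by_cases g1 : a = c + 1
  · exact Or.inr (Or.inl g1)
  have s1 := pos_succ hm a c
  rw [eq_iff a] at g1
  have c1 : Cyc4 (c + 1) a b c := by rw [cyc4_iff a]; omega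
  obtain ⟨a', b', c', e, q1, q2⟩ := hu (c + 1) (card_of_cyc4 c1).1
  obtain ⟨rfl, rfl, rfl⟩ := sort_unique c1 q1 e
  rw [pos_iff c1] at q2
  obtain ⟨q, c', hq, hq1, hq2⟩ := q2
  have : c' = c := by
    rw [cyc4_iff a] at hq2
    rw [eq_iff a] at hq2 ⊢
    omega
  subst this
  rw [cyc4_iff a, eq_iff a] at hq1
  by_cases g2 : q = a
  · subst g2; exact Or.inl (hA.1 _ _ hq)
  have g2' := g2
  rw [eq_iff a] at g2'
  have s2 := pos_succ hm a a
  have c2 : Cyc4 (a + 1) b c' a := by rw [cyc4_iff a]; omega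
  have e2 : ({b, c', a} : Finset (ZMod m)) = {a, b, c'} := set3_rot _ _ _
  obtain ⟨a1, b1, c1', e', r1, r2⟩ := hu (a + 1) (by rw [← e2]; exact (card_of_cyc4 c2).1)
  obtain ⟨rfl, rfl, rfl⟩ := sort_unique c2 r1 (e2.trans e')
  rw [pos_iff c2] at r2
  obtain ⟨p, a', hp, hp1, hp2⟩ := r2
  have : a' = a := by
    rw [cyc4_iff a] at hp2
    rw [eq_iff a] at hp2 ⊢
    omega
  subst this
  rw [cyc4_iff a', eq_iff a'] at hp1
  exfalso
  refine hA.2.2.1 _ _ _ _ (hA.1 _ _ hp) hq (cross_mk a' ?_ ?_ ?_) <;> omega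

set_option maxHeartbeats 2000000 in
theorem dn_edge (hm : 4 ≤ m) {A : Set (ZMod m × ZMod m)} (hA : IsTriangulation A)
    {a b c : ZMod m} (h : Cyc3 a b c)
    (hu : ∀ x ∉ ({a, b, c} : Finset (ZMod m)), Dn A {a, b, c} x) :
    EdgeOf (shiftOne A) c a := by
  have ha := pos_self a
  have h' := h
  unfold Cyc3 at h'
  by_cases g1 : a = c + 1
  · exact Or.inr (Or.inl g1)
  left
  show (c - 1, a - 1) ∈ A
  have s0 := pos_succ hm a c
  have s1 := pos_pred hm a a
  have s2 := pos_pred hm a c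
  rw [eq_iff a] at g1
  have lc := pos_lt a c
  have c1 : Cyc4 (a - 1) a b c := by rw [cyc4_iff a]; omega
  obtain ⟨a', b', c', e, q1, q2⟩ := hu (a - 1) (card_of_cyc4 c1).1
  obtain ⟨rfl, rfl, rfl⟩ := sort_unique c1 q1 e
  rw [neg_iff c1] at q2
  obtain ⟨a', q, hq, hq2, hq1⟩ := q2
  have l1 := pos_lt a a'
  have : a' = a - 1 := by
    rw [cyc4_iff a] at hq2
    rw [eq_iff a] at hq2 ⊢
    omega
  subst this
  rw [cyc4_iff a, eq_iff a] at hq1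
  by_cases g2 : q = c - 1
  · subst g2; exact hA.1 _ _ hq
  have g2' := g2
  rw [eq_iff a] at g2'
  have lq := pos_lt a q
  have c2 : Cyc4 (c - 1) c a b := by rw [cyc4_iff a]; omega
  have e2 : ({c, a, b} : Finset (ZMod m)) = {a, b, c} := set3_rot2 _ _ _
  obtain ⟨a1, b1, c1', e', r1, r2⟩ := hu (c - 1) (by rw [← e2]; exact (card_of_cyc4 c2).1)
  obtain ⟨rfl, rfl, rfl⟩ := sort_unique c2 r1 (e2.trans e')
  rw [neg_iff c2] at r2
  obtain ⟨c', p, hp, hp2, hp1⟩ := r2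
  have : c' = c - 1 := by
    rw [cyc4_iff a] at hp2
    rw [eq_iff a] at hp2 ⊢
    omega
  subst this
  rw [cyc4_iff a, eq_iff a] at hp1
  exfalso
  refine hA.2.2.1 _ _ _ _ (hA.1 _ _ hp) hq (cross_symm_right (cross_mk a ?_ ?_ ?_)) <;> omega

theorem tri_mk {B : Set (ZMod m × ZMod m)} (hs : ∀ x y, EdgeOf B x y → EdgeOf B y x)
    {a b c : ZMod m} (h : Cyc3 a b c)
    (h1 : EdgeOf B a b) (h2 : EdgeOf B b c) (h3 : EdgeOf B c a) : Tri B {a, b, c} := by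
  have hne : a ≠ b ∧ a ≠ c ∧ b ≠ c := by
    simp only [ne_eq, eq_iff a]
    have := pos_self a
    unfold Cyc3 at h
    omega
  refine ⟨Finset.card_eq_three.mpr ⟨a, b, c, hne.1, hne.2.1, hne.2.2, rfl⟩, ?_⟩
  have := hs _ _ h1
  have := hs _ _ h2
  have := hs _ _ h3
  intro x hx y hy hxy
  simp only [Finset.mem_insert, Finset.mem_singleton] at hx hy
  rcases hx with rfl | rfl | rfl <;> rcases hy with rfl | rfl | rfl <;>
    first | assumption | exact absurd rfl hxy

theorem shift_cyc4 {a b c d : ZMod m} :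
    Cyc4 (a - 1) (b - 1) (c - 1) (d - 1) ↔ Cyc4 a b c d := by
  simp [Cyc4, pos]

theorem shift_cross {a b c d : ZMod m} :
    Cross (a - 1) (b - 1) (c - 1) (d - 1) ↔ Cross a b c d := by
  simp [Cross, shift_cyc4]

theorem shift_diag {a b : ZMod m} : Diag (a - 1) (b - 1) ↔ Diag a b := by
  unfold Diag
  have h1 : b - 1 = a - 1 + 1 ↔ b = a + 1 := by
    constructor <;> intro h
    · linear_combination h
    · linear_combination h
  have h2 : a - 1 = b - 1 + 1 ↔ a = b + 1 := by
    constructor <;> intro h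
    · linear_combination h
    · linear_combination h
  rw [ne_eq, ne_eq, ne_eq, h1, h2, sub_left_inj]

theorem shift_tri {A : Set (ZMod m × ZMod m)} (hA : IsTriangulation A) :
    IsTriangulation (shiftOne A) := by
  refine ⟨fun x y h => hA.1 _ _ h, fun x y h => shift_diag.mp (hA.2.1 _ _ h),
    fun x y x' y' h h' hc => hA.2.2.1 _ _ _ _ h h' (shift_cross.mpr hc), ?_⟩
  intro x y hd h
  apply hA.2.2.2 _ _ (shift_diag.mpr hd)
  intro x' y' h' hc
  apply h (x' + 1) (y' + 1)
  · simpa [shiftOne] using h'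
  · rw [← shift_cross]; simpa using hc

theorem all_up_tri (hm : 4 ≤ m) {A : Set (ZMod m × ZMod m)} (hA : IsTriangulation A)
    {a b c : ZMod m} (h : Cyc3 a b c)
    (hu : ∀ x ∉ ({a, b, c} : Finset (ZMod m)), Up A {a, b, c} x) : Tri A {a, b, c} := by
  have e1 : ({b, c, a} : Finset (ZMod m)) = {a, b, c} := set3_rot _ _ _
  have e2 : ({c, a, b} : Finset (ZMod m)) = {a, b, c} := set3_rot2 _ _ _
  refine tri_mk (fun _ _ => edge_symm hA) h ?_ ?_ (up_edge hm hA h hu)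
  · exact up_edge hm hA (cyc3_rot h) (by rw [e1]; exact hu)
  · exact up_edge hm hA (cyc3_rot (cyc3_rot h)) (by rw [e2]; exact hu)

theorem all_dn_tri (hm : 4 ≤ m) {A : Set (ZMod m × ZMod m)} (hA : IsTriangulation A)
    {a b c : ZMod m} (h : Cyc3 a b c)
    (hu : ∀ x ∉ ({a, b, c} : Finset (ZMod m)), Dn A {a, b, c} x) :
    Tri (shiftOne A) {a, b, c} := by
  have e1 : ({b, c, a} : Finset (ZMod m)) = {a, b, c} := set3_rot _ _ _
  have e2 : ({c, a, b} : Finset (ZMod m)) = {a, b, c} := set3_rot2 _ _ _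
  refine tri_mk (fun _ _ => edge_symm (shift_tri hA)) h ?_ ?_ (dn_edge hm hA h hu)
  · exact dn_edge hm hA (cyc3_rot h) (by rw [e1]; exact hu)
  · exact dn_edge hm hA (cyc3_rot (cyc3_rot h)) (by rw [e2]; exact hu)

theorem facet_tri (hm : 4 ≤ m) {A : Set (ZMod m × ZMod m)} (hA : IsTriangulation A)
    {a b c : ZMod m} (h : IsFacet A a b c) :
    ((∀ x ∉ ({a, b, c} : Finset (ZMod m)), Up A {a, b, c} x) ∧ Tri A {a, b, c}) ∨
    ((∀ x ∉ ({a, b, c} : Finset (ZMod m)), Dn A {a, b, c} x) ∧ Tri (shiftOne A) {a, b, c}) := by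
  rcases facet_cases hA h with h' | h'
  · exact Or.inl ⟨h', all_up_tri hm hA h.1 h'⟩
  · exact Or.inr ⟨h', all_dn_tri hm hA h.1 h'⟩

end Facets
end CyclicTri

namespace CyclicTri
section Flips
set_option linter.unusedSectionVars false
variable {m : ℕ} [NeZero m]

theorem chi_rot (hm : 4 ≤ m) {A : Set (ZMod m × ZMod m)} (hA : IsTriangulation A)
    {a b c d : ZMod m} (h : Cyc4 a b c d) : chiCyc A b c d a = - chiCyc A a b c d := by
  rcases pos_or_neg hm hA h with h1 | h1
  · rw [chi_one.mpr h1, (chi_neg hA).mpr ((neg_rot h).mpr h1)]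
  · rw [(chi_neg hA).mpr h1, chi_one.mpr ((pos_rot hA h).mpr h1)]; rfl

theorem overlap_mk {A : Set (ZMod m × ZMod m)} {σ τ : Finset (ZMod m)} (v : Fin 5 → ZMod m)
    (hv : Cyc5 v) (k : Fin 5) (s : ℤ) (hs : s = 1 ∨ s = -1) (h0 : circSign A v 0 = s)
    (hk : circSign A v k = -s) (hσ : ∀ i, i ≠ k → v i ∈ σ) (hτ : ∀ i, i ≠ 0 → v i ∈ τ) :
    Overlap A σ τ := by
  refine ⟨v, hv, s, hs, fun i hi => hσ i ?_, 0, h0, hτ⟩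
  rintro rfl
  omega

theorem overlap_same (hm : 4 ≤ m) {A : Set (ZMod m × ZMod m)} (hA : IsTriangulation A)
    {x y a b c a' b' c' : ZMod m} {s : ℤ} (hs : s = 1 ∨ s = -1) (hxy : x ≠ y)
    (hx : Cyc4 x a b c) (hy : Cyc4 y a' b' c')
    (e : ({a, b, c} : Finset (ZMod m)) = {a', b', c'})
    (sx : chiCyc A x a b c = s) (sy : chiCyc A y a' b' c' = s) :
    Overlap A (insert x {a, b, c}) (insert y {a, b, c}) := by
  have hs' : -s = 1 ∨ -s = -1 := by omega
  have hyF : y ∉ ({a, b, c} : Finset (ZMod m)) := by rw [e]; exact (card_of_cyc4 hy).1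
  simp only [Finset.mem_insert, Finset.mem_singleton, not_or] at hyF
  simp only [ne_eq, eq_iff x] at hxy hyF
  have h0 := pos_self x
  have hx' := hx
  unfold Cyc4 at hx'
  rcases lt_or_ge (pos x y) (pos x a) with g | g
  · have r : Cyc4 y a b c := by rw [cyc4_iff x]; omega
    obtain ⟨rfl, rfl, rfl⟩ := sort_unique r hy e
    refine overlap_mk ![x, y, a, b, c] ?_ 1 s hs ?_ ?_ ?_ ?_
    · simp [Cyc5]; omega
    · simpa [circSign] using sy
    · simpa [circSign] using sx
    · intro i hi; fin_cases i <;> simp at hi ⊢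
    · intro i hi; fin_cases i <;> simp at hi ⊢
  rcases lt_or_ge (pos x y) (pos x b) with g | g
  · have r0 : Cyc4 a y b c := by rw [cyc4_iff x]; omega
    have r := cyc4_rot r0
    obtain ⟨rfl, rfl, rfl⟩ := sort_unique r hy ((set3_rot _ _ _).trans e)
    rw [chi_rot hm hA r0] at sy
    refine overlap_mk ![x, a, y, b, c] ?_ 2 (-s) hs' ?_ ?_ ?_ ?_
    · simp [Cyc5]; omega
    · simp [circSign]; omega
    · simp [circSign]; omega
    · intro i hi; fin_cases i <;> simp at hi ⊢
    · intro i hi; fin_cases i <;> simp at hi ⊢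
  rcases lt_or_ge (pos x y) (pos x c) with g | g
  · have r0 : Cyc4 a b y c := by rw [cyc4_iff x]; omega
    have r := cyc4_rot (cyc4_rot r0)
    obtain ⟨rfl, rfl, rfl⟩ := sort_unique r hy ((set3_rot2 _ _ _).trans e)
    rw [chi_rot hm hA (cyc4_rot r0), chi_rot hm hA r0] at sy
    refine overlap_mk ![x, a, b, y, c] ?_ 3 s hs ?_ ?_ ?_ ?_
    · simp [Cyc5]; omega
    · simp [circSign]; omega
    · simp [circSign]; omega
    · intro i hi; fin_cases i <;> simp at hi ⊢
    · intro i hi; fin_cases i <;> simp at hi ⊢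
  · have r : Cyc4 y a b c := by rw [cyc4_iff x]; omega
    obtain ⟨rfl, rfl, rfl⟩ := sort_unique r hy e
    have := chi_rot hm hA r
    refine overlap_mk ![x, a, b, c, y] ?_ 4 (-s) hs' ?_ ?_ ?_ ?_
    · simp [Cyc5]; omega
    · simp [circSign]; omega
    · simp [circSign]; omega
    · intro i hi; fin_cases i <;> simp at hi ⊢
    · intro i hi; fin_cases i <;> simp at hi ⊢

theorem overlap_up (hm : 4 ≤ m) {A : Set (ZMod m × ZMod m)} (hA : IsTriangulation A)
    {F : Finset (ZMod m)} {x y : ZMod m} (hxy : x ≠ y) (hx : Up A F x) (hy : Up A F y) :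
    Overlap A (insert x F) (insert y F) := by
  obtain ⟨a, b, c, rfl, h1, h2⟩ := hx
  obtain ⟨a', b', c', e, h1', h2'⟩ := hy
  exact overlap_same hm hA (Or.inl rfl) hxy h1 h1' e (chi_one.mpr h2) (chi_one.mpr h2')

theorem overlap_dn (hm : 4 ≤ m) {A : Set (ZMod m × ZMod m)} (hA : IsTriangulation A)
    {F : Finset (ZMod m)} {x y : ZMod m} (hxy : x ≠ y) (hx : Dn A F x) (hy : Dn A F y) :
    Overlap A (insert x F) (insert y F) := by
  obtain ⟨a, b, c, rfl, h1, h2⟩ := hx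
  obtain ⟨a', b', c', e, h1', h2'⟩ := hy
  exact overlap_same hm hA (Or.inr rfl) hxy h1 h1' e ((chi_neg hA).mpr h2) ((chi_neg hA).mpr h2')

def flipSet (B : Set (ZMod m × ZMod m)) (a b c d : ZMod m) : Set (ZMod m × ZMod m) :=
  (B \ {(a, c), (c, a)}) ∪ {(b, d), (d, b)}

theorem mem_flip {B : Set (ZMod m × ZMod m)} {a b c d x y : ZMod m} :
    (x, y) ∈ flipSet B a b c d ↔
      ((x, y) ∈ B ∧ ¬ (x = a ∧ y = c) ∧ ¬ (x = c ∧ y = a)) ∨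
        (x = b ∧ y = d) ∨ (x = d ∧ y = b) := by
  simp [flipSet, Prod.ext_iff]
  tauto

/-- An arc crossing `a c` but none of the sides of the quadrilateral is `b d`. -/
theorem cross_ac {a b c d x y : ZMod m} (h : Cyc4 a b c d) (hc : Cross a c x y)
    (h1 : ¬ Cross a b x y) (h2 : ¬ Cross b c x y) (h3 : ¬ Cross c d x y)
    (h4 : ¬ Cross d a x y) : (x = b ∧ y = d) ∨ (x = d ∧ y = b) := by
  have ha := pos_self a
  have h' := h
  unfold Cyc4 at h'
  have key : ∀ x y, ¬ Cross a b x y → ¬ Cross b c x y → ¬ Cross c d x y → ¬ Cross d a x y →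
      0 < pos a x → pos a x < pos a c → pos a c < pos a y → x = b ∧ y = d := by
    intro x y h1 h2 h3 h4 g1 g2 g3
    have k1 : ¬ pos a x < pos a b := fun hh => h1 (cross_mk a (by omega) hh (by omega))
    have k2 : ¬ pos a b < pos a x := fun hh => h2 (cross_mk a hh g2 (by omega))
    have k3 : ¬ pos a y < pos a d := fun hh =>
      h3 (cross_symm_right (cross_mk a g3 hh (by omega)))
    have k4 : ¬ pos a d < pos a y := fun hh =>
      h4 (Or.inl (by rw [cyc4_iff a]; omega) |> cross_symm_right)
    rw [eq_iff a, eq_iff a]; omega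
  rcases cross_cases a hc (by omega) with g | g
  · exact Or.inl (key x y h1 h2 h3 h4 (by omega) (by omega) (by omega))
  · right
    have := key y x (fun h => h1 (cross_symm_right h)) (fun h => h2 (cross_symm_right h))
      (fun h => h3 (cross_symm_right h)) (fun h => h4 (cross_symm_right h))
      (by omega) (by omega) (by omega)
    exact ⟨this.2, this.1⟩

theorem edge_flip {B : Set (ZMod m × ZMod m)} {a b c d x y : ZMod m} (h : EdgeOf B x y)
    (h1 : ¬ (x = a ∧ y = c)) (h2 : ¬ (x = c ∧ y = a)) : EdgeOf (flipSet B a b c d) x y := by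
  rcases h with h | h
  · exact Or.inl (mem_flip.mpr (Or.inl ⟨h, h1, h2⟩))
  · exact Or.inr h

theorem edge_unflip {B : Set (ZMod m × ZMod m)} {a b c d x y : ZMod m}
    (h : EdgeOf (flipSet B a b c d) x y)
    (h1 : ¬ (x = b ∧ y = d)) (h2 : ¬ (x = d ∧ y = b)) : EdgeOf B x y := by
  rcases h with h | h
  · rcases mem_flip.mp h with h | h | h
    · exact Or.inl h.1
    · exact absurd h h1
    · exact absurd h h2
  · exact Or.inr h

structure Quad (B : Set (ZMod m × ZMod m)) (a b c d : ZMod m) : Prop where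
  cyc : Cyc4 a b c d
  ab : EdgeOf B a b
  bc : EdgeOf B b c
  cd : EdgeOf B c d
  da : EdgeOf B d a

theorem quad_flip {B : Set (ZMod m × ZMod m)} {a b c d : ZMod m} (q : Quad B a b c d) :
    Quad (flipSet B a b c d) a b c d := by
  obtain ⟨h1, h2, h3, h4, h5, h6⟩ := cyc4_ne q.cyc
  refine ⟨q.cyc, edge_flip q.ab ?_ ?_, edge_flip q.bc ?_ ?_, edge_flip q.cd ?_ ?_,
    edge_flip q.da ?_ ?_⟩ <;> rintro ⟨h, h'⟩ <;> simp_all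

theorem flip_triangulation (hm : 4 ≤ m) {B : Set (ZMod m × ZMod m)} (hB : IsTriangulation B)
    {a b c d : ZMod m} (q : Quad B a b c d) (hac : (a, c) ∈ B) :
    IsTriangulation (flipSet B a b c d) := by
  obtain ⟨h1, h2, h3, h4, h5, h6⟩ := cyc4_ne q.cyc
  have hbd : Diag b d := by
    have := q.cyc
    unfold Cyc4 at this
    rw [diag_iff hm a]
    have := pos_lt a d
    omega
  have hx : ∀ x y, (x, y) ∈ B → Cross b d x y → (x = a ∧ y = c) ∨ (x = c ∧ y = a) := by
    intro x y hxy hc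
    have n := fun {p q} (he : EdgeOf B p q) => edge_noncross hm hB he (Or.inl hxy)
    have := cross_ac (cyc4_rot q.cyc) hc (n q.bc) (n q.cd) (n q.da) (n q.ab)
    tauto
  refine ⟨?_, ?_, ?_, ?_⟩
  · intro x y h
    rw [mem_flip] at h ⊢
    have := hB.1 x y
    tauto
  · intro x y h
    rw [mem_flip] at h
    rcases h with h | ⟨rfl, rfl⟩ | ⟨rfl, rfl⟩
    · exact hB.2.1 _ _ h.1
    · exact hbd
    · exact ⟨hbd.1.symm, hbd.2.2, hbd.2.1⟩
  · intro x y x' y' h h' hc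
    rw [mem_flip] at h h'
    have self : ∀ p q : ZMod m, ¬ Cross p q p q := by
      intro p q h
      rcases h with h | h <;> exact (cyc4_ne h).1 rfl
    rcases h with h | ⟨rfl, rfl⟩ | ⟨rfl, rfl⟩ <;> rcases h' with h' | ⟨rfl, rfl⟩ | ⟨rfl, rfl⟩
    · exact hB.2.2.1 _ _ _ _ h.1 h'.1 hc
    · have := hx _ _ h.1 (cross_comm hc); tauto
    · have := hx _ _ h.1 (cross_symm_left (cross_comm hc)); tauto
    · have := hx _ _ h'.1 hc; tauto
    · exact self _ _ hc
    · exact self _ _ (cross_symm_right hc)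
    · have := hx _ _ h'.1 (cross_symm_left hc); tauto
    · exact self _ _ (cross_symm_right hc)
    · exact self _ _ hc
  · intro x y hd hn
    have hedge : ∀ p q, EdgeOf (flipSet B a b c d) p q → ¬ Cross p q x y := by
      intro p q he hc
      rcases he with he | he | he
      · exact hn _ _ he (cross_comm hc)
      · subst he; exact succ_noncross hm hc
      · subst he; exact succ_noncross hm (cross_symm_left hc)
    have q' := quad_flip q
    by_cases hc : Cross a c x y
    · have := cross_ac q.cyc hc (hedge _ _ q'.ab) (hedge _ _ q'.bc) (hedge _ _ q'.cd)
        (hedge _ _ q'.da)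
      exact mem_flip.mpr (Or.inr this)
    · have hxy : (x, y) ∈ B := by
        apply hB.2.2.2 _ _ hd
        intro x' y' h' hc'
        by_cases e1 : x' = a ∧ y' = c
        · rw [e1.1, e1.2] at hc'; exact hc (cross_comm hc')
        by_cases e2 : x' = c ∧ y' = a
        · rw [e2.1, e2.2] at hc'; exact hc (cross_symm_left (cross_comm hc'))
        exact hn _ _ (mem_flip.mpr (Or.inl ⟨h', e1, e2⟩)) hc'
      have hbd' : ¬ Cross x y b d := hn _ _ (mem_flip.mpr (Or.inr (Or.inl ⟨rfl, rfl⟩)))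
      refine mem_flip.mpr (Or.inl ⟨hxy, ?_, ?_⟩)
      · rintro ⟨rfl, rfl⟩; exact hbd' (Or.inl q.cyc)
      · rintro ⟨rfl, rfl⟩; exact hbd' (cross_symm_left (Or.inl q.cyc))

/-- third vertex of a triangle over a diagonal of a quadrilateral -/
theorem third (hm : 4 ≤ m) {B : Set (ZMod m × ZMod m)} (hB : IsTriangulation B)
    {a b c d z : ZMod m} (q : Quad B a b c d) (hza : z ≠ a) (hzc : z ≠ c)
    (h1 : EdgeOf B a z) (h2 : EdgeOf B c z) : z = b ∨ z = d := by
  have h := q.cyc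
  unfold Cyc4 at h
  have ha := pos_self a
  rw [ne_eq, eq_iff a] at hza hzc
  rw [eq_iff a, eq_iff a]
  rcases lt_or_ge (pos a z) (pos a c) with g | g
  · left
    have k1 : ¬ pos a z < pos a b := fun hh =>
      edge_noncross hm hB q.ab h2 (cross_symm_right (cross_mk a (by omega) hh (by omega)))
    have k2 : ¬ pos a b < pos a z := fun hh =>
      edge_noncross hm hB q.bc h1 (cross_symm_right (cross_mk a hh g (by omega)))
    omega
  · right
    have k1 : ¬ pos a z < pos a d := fun hh =>
      edge_noncross hm hB q.cd h1 (cross_symm_right (cross_mk a (by omega) hh (by omega)))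
    have k2 : ¬ pos a d < pos a z := fun hh =>
      edge_noncross hm hB q.da h2
        (cross_symm_right (Or.inl (by rw [cyc4_iff a]; omega)))
    omega

theorem exists_third {F : Finset (ZMod m)} (hF : F.card = 3) {a c : ZMod m} (ha : a ∈ F)
    (hc : c ∈ F) (hac : a ≠ c) : ∃ z, z ≠ a ∧ z ≠ c ∧ F = {a, c, z} := by
  have h1 : ((F.erase a).erase c).card = 1 := by
    rw [Finset.card_erase_of_mem (by simp [hc, hac.symm]), Finset.card_erase_of_mem ha, hF]
  obtain ⟨z, hz⟩ := Finset.card_eq_one.mp h1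
  have hz' : z ∈ (F.erase a).erase c := by rw [hz]; simp
  simp only [Finset.mem_erase] at hz'
  refine ⟨z, hz'.2.1, hz'.1, ?_⟩
  rw [← hz, Finset.insert_erase (by simp [hc, hac.symm]), Finset.insert_erase ha]

theorem tri_third (hm : 4 ≤ m) {B : Set (ZMod m × ZMod m)} (hB : IsTriangulation B)
    {a b c d : ZMod m} (q : Quad B a b c d) {F : Finset (ZMod m)} (hF : Tri B F)
    (ha : a ∈ F) (hc : c ∈ F) : F = {a, b, c} ∨ F = {a, c, d} := by
  have hac := (cyc4_ne q.cyc).2.1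
  obtain ⟨z, hza, hzc, rfl⟩ := exists_third hF.1 ha hc hac
  rcases third hm hB q hza hzc (hF.2 a ha z (by simp) hza.symm) (hF.2 c hc z (by simp) hzc.symm)
    with rfl | rfl
  · left; ext; simp; tauto
  · right; rfl

theorem quad_rot {B : Set (ZMod m × ZMod m)} {a b c d : ZMod m} (q : Quad B a b c d) :
    Quad B b c d a := ⟨cyc4_rot q.cyc, q.bc, q.cd, q.da, q.ab⟩

theorem flip_tri (hm : 4 ≤ m) {B : Set (ZMod m × ZMod m)} (hB : IsTriangulation B)
    {a b c d : ZMod m} (q : Quad B a b c d) (hac : (a, c) ∈ B) (F : Finset (ZMod m)) :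
    Tri (flipSet B a b c d) F ↔
      (Tri B F ∧ ¬ (F = {a, b, c} ∨ F = {a, c, d})) ∨ (F = {a, b, d} ∨ F = {b, c, d}) := by
  have hB' := flip_triangulation hm hB q hac
  have q' := quad_flip q
  obtain ⟨h1, h2, h3, h4, h5, h6⟩ := cyc4_ne q.cyc
  have hbd : EdgeOf (flipSet B a b c d) b d := Or.inl (mem_flip.mpr (Or.inr (Or.inl ⟨rfl, rfl⟩)))
  have hnac : ¬ EdgeOf (flipSet B a b c d) a c := fun h =>
    edge_noncross hm hB' h hbd (Or.inl q.cyc)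
  have hc := q.cyc
  unfold Cyc4 at hc
  have ha := pos_self a
  constructor
  · intro hF
    by_cases hb : b ∈ F ∧ d ∈ F
    · right
      rcases tri_third hm hB' (quad_rot q') hF hb.1 hb.2 with h | h
      · right; exact h
      · left; rw [h]; ext; simp; tauto
    · left
      refine ⟨⟨hF.1, fun x hx y hy hxy => edge_unflip (hF.2 x hx y hy hxy) ?_ ?_⟩, ?_⟩
      · rintro ⟨rfl, rfl⟩; exact hb ⟨hx, hy⟩
      · rintro ⟨rfl, rfl⟩; exact hb ⟨hy, hx⟩
      · rintro (rfl | rfl) <;> exact hnac (hF.2 a (by simp) c (by simp) h2)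
  · rintro (⟨hF, hn⟩ | rfl | rfl)
    · have : ¬ (a ∈ F ∧ c ∈ F) := fun h => hn (tri_third hm hB q hF h.1 h.2)
      refine ⟨hF.1, fun x hx y hy hxy => edge_flip (hF.2 x hx y hy hxy) ?_ ?_⟩
      · rintro ⟨rfl, rfl⟩; exact this ⟨hx, hy⟩
      · rintro ⟨rfl, rfl⟩; exact this ⟨hy, hx⟩
    · refine tri_mk (fun _ _ => edge_symm hB') ?_ q'.ab hbd q'.da
      rw [cyc3_iff a]; omega
    · refine tri_mk (fun _ _ => edge_symm hB') ?_ q'.bc q'.cd (edge_symm hB' hbd)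
      rw [cyc3_iff a]; omega

/-- An arc of `A` is not an arc of the rotated triangulation. -/
theorem shift_disj (hm : 4 ≤ m) {A : Set (ZMod m × ZMod m)} (hA : IsTriangulation A)
    {x y : ZMod m} (h : (x, y) ∈ A) (h' : (x, y) ∈ shiftOne A) : False := by
  have h'' : (x - 1, y - 1) ∈ A := h'
  apply hA.2.2.1 _ _ _ _ h h''
  have hd := hA.2.1 _ _ h
  rw [diag_iff hm x] at hd
  have h0 := pos_self x
  have := pos_pred hm x x
  have := pos_pred hm x y
  have := pos_lt x y
  exact cross_symm_right (cross_mk x (by omega) (by omega) (by omega))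

theorem side_subset (hm : 4 ≤ m) {A B : Set (ZMod m × ZMod m)} (hA : IsTriangulation A)
    (hB : IsTriangulation B) (hT : ∀ F, Tri B F → Tri A F ∨ Tri (shiftOne A) F) :
    ∀ n : ℕ, ∀ x y p q, pos x y = n → (x, y) ∈ A → (x, y) ∈ B → (p, q) ∈ B →
      pos x p < pos x q → pos x q ≤ pos x y → (p, q) ∈ A := by
  intro n
  induction n using Nat.strong_induction_on with
  | _ n ih =>
    intro x y p q hn hxA hxB hpB h1 h2
    have h0 := pos_self x
    have hdp := hB.2.1 _ _ hpB
    rw [diag_iff hm x] at hdp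
    obtain ⟨z, z1, z2, z3, z4⟩ := exists_apex hm hB (Or.inl hxB) (by omega)
    have hc3 : Cyc3 x z y := ⟨z1, z2⟩
    have hxy : x ≠ y := (hB.2.1 _ _ hxB).1
    have hxz : x ≠ z := by rintro rfl; omega
    have hzy : z ≠ y := by rintro rfl; omega
    have htri : Tri B {x, z, y} :=
      tri_mk (fun _ _ => edge_symm hB) hc3 z3 z4 (edge_symm hB (Or.inl hxB))
    have htA : Tri A {x, z, y} := by
      rcases hT _ htri with h | h
      · exact h
      · exfalso
        rcases h.2 x (by simp) y (by simp) hxy with h | h | h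
        · exact shift_disj hm hA hxA h
        · exact (hB.2.1 _ _ hxB).2.1 h
        · exact (hB.2.1 _ _ hxB).2.2 h
    have lz := pos_lt x z
    have ly := pos_lt x y
    have bz := pos_base x z y
    have bp := pos_base x z p
    have bq := pos_base x z q
    have lq := pos_lt z q
    have lp := pos_lt z p
    rcases le_or_gt (pos x q) (pos x z) with g | g
    · have hd : Diag x z := by rw [diag_iff hm x]; omega
      have m1 : (x, z) ∈ B := by
        rcases z3 with h | h | h
        · exact h
        · exact absurd h hd.2.1
        · exact absurd h hd.2.2
      have m2 : (x, z) ∈ A := by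
        rcases htA.2 x (by simp) z (by simp) hxz with h | h | h
        · exact h
        · exact absurd h hd.2.1
        · exact absurd h hd.2.2
      exact ih (pos x z) (by omega) x z p q rfl m2 m1 hpB h1 g
    rcases lt_or_ge (pos x p) (pos x z) with g' | g'
    · have e1 : ¬ 0 < pos x p := fun hh =>
        edge_noncross hm hB z3 (Or.inl hpB) (cross_mk x (by omega) g' (by omega))
      have e2 : ¬ pos x q < pos x y := fun hh =>
        edge_noncross hm hB z4 (Or.inl hpB)
          (cross_symm_right (cross_mk x g hh (by omega)))
      have : p = x := by rw [eq_iff x]; omega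
      have : q = y := by rw [eq_iff x]; omega
      subst p; subst q; exact hxA
    · have hd : Diag z y := by rw [diag_iff hm x]; omega
      have m1 : (z, y) ∈ B := by
        rcases z4 with h | h | h
        · exact h
        · exact absurd h hd.2.1
        · exact absurd h hd.2.2
      have m2 : (z, y) ∈ A := by
        rcases htA.2 z (by simp) y (by simp) hzy with h | h | h
        · exact h
        · exact absurd h hd.2.1
        · exact absurd h hd.2.2
      exact ih (pos z y) (by omega) z y p q rfl m2 m1 hpB (by omega) (by omega)

theorem eq_of_subset {A B : Set (ZMod m × ZMod m)} (hA : IsTriangulation A)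
    (hB : IsTriangulation B) (h : B ⊆ A) : B = A := by
  apply Set.Subset.antisymm h
  rintro ⟨x, y⟩ hxy
  exact hB.2.2.2 _ _ (hA.2.1 _ _ hxy) (fun x' y' h' => hA.2.2.1 _ _ _ _ hxy (h h'))

theorem all_subset (hm : 4 ≤ m) {A B : Set (ZMod m × ZMod m)} (hA : IsTriangulation A)
    (hB : IsTriangulation B) (hT : ∀ F, Tri B F → Tri A F ∨ Tri (shiftOne A) F)
    {x y : ZMod m} (hxA : (x, y) ∈ A) (hxB : (x, y) ∈ B) : B ⊆ A := by
  have key : ∀ p q, (p, q) ∈ B → pos x p < pos x q → (p, q) ∈ A := by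
    intro p q hpq h
    have h0 := pos_self x
    have side := fun x y p q => side_subset hm hA hB hT _ x y p q rfl
    rcases le_or_gt (pos x q) (pos x y) with g | g
    · exact side x y p q hxA hxB hpq h g
    · have n := hB.2.2.1 _ _ _ _ hxB hpq
      have e : ¬ (0 < pos x p ∧ pos x p < pos x y) := fun hh =>
        n (cross_mk x (by omega) hh.2 (by omega))
      have b1 := pos_base x y p
      have b2 := pos_base x y q
      have b3 := pos_base x y x
      have l1 := pos_lt x p
      have l2 := pos_lt x q
      have l3 := pos_lt x y
      have hne := (hA.2.1 _ _ hxA).1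
      rw [ne_eq, eq_iff x] at hne
      by_cases hp : 0 < pos x p
      · exact side y x p q (hA.1 _ _ hxA) (hB.1 _ _ hxB) hpq (by omega) (by omega)
      · exact hA.1 _ _ (side y x q p (hA.1 _ _ hxA) (hB.1 _ _ hxB) (hB.1 _ _ hpq)
          (by omega) (by omega))
  rintro ⟨p, q⟩ hpq
  rcases lt_trichotomy (pos x p) (pos x q) with h | h | h
  · exact key p q hpq h
  · exact absurd (pos_inj h) (hB.2.1 _ _ hpq).1
  · exact hA.1 _ _ (key q p (hB.1 _ _ hpq) h)

/-- An arc of a triangulation is a side of a triangle. -/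
theorem exists_tri (hm : 4 ≤ m) {B : Set (ZMod m × ZMod m)} (hB : IsTriangulation B)
    {x y : ZMod m} (h : (x, y) ∈ B) : ∃ F, Tri B F ∧ x ∈ F ∧ y ∈ F := by
  have hd := hB.2.1 _ _ h
  rw [diag_iff hm x] at hd
  have h0 := pos_self x
  obtain ⟨z, z1, z2, z3, z4⟩ := exists_apex hm hB (Or.inl h) (by omega)
  exact ⟨{x, z, y}, tri_mk (fun _ _ => edge_symm hB) ⟨z1, z2⟩ z3 z4 (edge_symm hB (Or.inl h)),
    by simp, by simp⟩

theorem final_eq (hm : 4 ≤ m) {A B : Set (ZMod m × ZMod m)} (hA : IsTriangulation A)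
    (hB : IsTriangulation B) (hT : ∀ F, Tri B F → Tri A F ∨ Tri (shiftOne A) F) :
    B = A ∨ B = shiftOne A := by
  by_cases h : ∃ x y, (x, y) ∈ A ∧ (x, y) ∈ B
  · obtain ⟨x, y, h1, h2⟩ := h
    exact Or.inl (eq_of_subset hA hB (all_subset hm hA hB hT h1 h2))
  · right
    refine eq_of_subset (shift_tri hA) hB ?_
    rintro ⟨x, y⟩ hxy
    obtain ⟨F, hF, hx, hy⟩ := exists_tri hm hB hxy
    have hd := hB.2.1 _ _ hxy
    rcases hT F hF with h' | h'
    · rcases h'.2 x hx y hy hd.1 with h' | h' | h'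
      · exact absurd ⟨x, y, h', hxy⟩ h
      · exact absurd h' hd.2.1
      · exact absurd h' hd.2.2
    · rcases h'.2 x hx y hy hd.1 with h' | h' | h'
      · exact h'
      · exact absurd h' hd.2.1
      · exact absurd h' hd.2.2

end Flips
end CyclicTri

namespace CyclicTri
section Main
set_option linter.unusedSectionVars false
variable {m : ℕ} [NeZero m]

/-- Lower facets of a simplex of a matroid triangulation: dichotomy. -/
theorem other_simplex {Δ : Finset (Finset (ZMod m))} (hcard : ∀ σ ∈ Δ, σ.card = 4)
    {F σ : Finset (ZMod m)} (hF : F.card = 3)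
    (h : (Δ.filter (fun τ => F ⊆ τ)).card = 2) :
    ∃ τ ∈ Δ, τ ≠ σ ∧ ∃ y, y ∉ F ∧ τ = insert y F := by
  obtain ⟨τ, hτ, hne⟩ := Finset.exists_mem_ne (by omega : 1 < (Δ.filter (fun τ => F ⊆ τ)).card) σ
  rw [Finset.mem_filter] at hτ
  refine ⟨τ, hτ.1, hne, ?_⟩
  have hs : (τ \ F).card = 1 := by
    rw [Finset.card_sdiff_of_subset hτ.2, hcard τ hτ.1, hF]
  obtain ⟨y, hy⟩ := Finset.card_eq_one.mp hs
  have hy' : y ∈ τ \ F := by rw [hy]; simp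
  rw [Finset.mem_sdiff] at hy'
  refine ⟨y, hy'.2, ?_⟩
  rw [Finset.insert_eq, ← hy, Finset.sdiff_union_of_subset hτ.2]

variable {A : Set (ZMod m × ZMod m)} {Δ : Finset (Finset (ZMod m))}

/-- Two simplices of `Δ` with a common lower facet agree. -/
theorem lower_unique (hm : 4 ≤ m) (hA : IsTriangulation A) (hΔ : IsMatTriangulation A Δ)
    {F σ τ : Finset (ZMod m)} (hσ : σ ∈ Δ) (hτ : τ ∈ Δ) (h1 : IsLowerFacetOf A F σ)
    (h2 : IsLowerFacetOf A F τ) : σ = τ := by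
  obtain ⟨x, rfl, hx⟩ := (lower_iff hA).mp h1
  obtain ⟨y, rfl, hy⟩ := (lower_iff hA).mp h2
  by_contra hne
  refine hΔ.2.2.2 _ hσ _ hτ (overlap_dn hm hA ?_ hx hy)
  rintro rfl; exact hne rfl

theorem upper_unique (hm : 4 ≤ m) (hA : IsTriangulation A) (hΔ : IsMatTriangulation A Δ)
    {F σ τ : Finset (ZMod m)} (hσ : σ ∈ Δ) (hτ : τ ∈ Δ) (h1 : IsUpperFacetOf A F σ)
    (h2 : IsUpperFacetOf A F τ) : σ = τ := by
  obtain ⟨x, rfl, hx⟩ := (upper_iff hA).mp h1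
  obtain ⟨y, rfl, hy⟩ := (upper_iff hA).mp h2
  by_contra hne
  refine hΔ.2.2.2 _ hσ _ hτ (overlap_up hm hA ?_ hx hy)
  rintro rfl; exact hne rfl

theorem not_upper_lower (hA : IsTriangulation A) {F σ : Finset (ZMod m)}
    (h1 : IsUpperFacetOf A F σ) (h2 : IsLowerFacetOf A F σ) : False := by
  obtain ⟨x, rfl, hx⟩ := (upper_iff hA).mp h1
  obtain ⟨y, e, hy⟩ := (lower_iff hA).mp h2
  have : x ∈ insert y F := by rw [← e]; simp
  rcases Finset.mem_insert.mp this with rfl | h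
  · exact not_up_dn hA hx hy
  · exact (up_card hx).1 h

theorem lower_alt (hm : 4 ≤ m) (hA : IsTriangulation A) (hΔ : IsMatTriangulation A Δ)
    {F σ : Finset (ZMod m)} (hσ : σ ∈ Δ) (h : IsLowerFacetOf A F σ) :
    Tri (shiftOne A) F ∨ ∃ τ ∈ Δ, IsUpperFacetOf A F τ := by
  obtain ⟨x, rfl, hx⟩ := (lower_iff hA).mp h
  obtain ⟨hxF, hF⟩ := dn_card hx
  rcases hΔ.2.2.1 _ hσ F (Finset.subset_insert _ _) hF with ⟨a, b, c, -, rfl, hf⟩ | h2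
  · rcases facet_tri hm hA hf with ⟨h1, -⟩ | ⟨-, h1⟩
    · exact absurd hx (fun hx => not_up_dn hA (h1 x hxF) hx)
    · exact Or.inl h1
  · right
    obtain ⟨τ, hτ, hne, y, hy, rfl⟩ := other_simplex (σ := insert x F) hΔ.2.1 hF h2
    refine ⟨_, hτ, ?_⟩
    rcases up_or_dn hm hA hy hF with h3 | h3
    · exact (upper_iff hA).mpr ⟨y, rfl, h3⟩
    · exact absurd (lower_unique hm hA hΔ hτ hσ ((lower_iff hA).mpr ⟨y, rfl, h3⟩) h) hne

theorem upper_alt (hm : 4 ≤ m) (hA : IsTriangulation A) (hΔ : IsMatTriangulation A Δ)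
    {F σ : Finset (ZMod m)} (hσ : σ ∈ Δ) (h : IsUpperFacetOf A F σ) :
    Tri A F ∨ ∃ τ ∈ Δ, IsLowerFacetOf A F τ := by
  obtain ⟨x, rfl, hx⟩ := (upper_iff hA).mp h
  obtain ⟨hxF, hF⟩ := up_card hx
  rcases hΔ.2.2.1 _ hσ F (Finset.subset_insert _ _) hF with ⟨a, b, c, -, rfl, hf⟩ | h2
  · rcases facet_tri hm hA hf with ⟨-, h1⟩ | ⟨h1, -⟩
    · exact Or.inl h1
    · exact absurd hx (fun hx => not_up_dn hA hx (h1 x hxF))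
  · right
    obtain ⟨τ, hτ, hne, y, hy, rfl⟩ := other_simplex (σ := insert x F) hΔ.2.1 hF h2
    refine ⟨_, hτ, ?_⟩
    rcases up_or_dn hm hA hy hF with h3 | h3
    · exact absurd (upper_unique hm hA hΔ hτ hσ ((upper_iff hA).mpr ⟨y, rfl, h3⟩) h) hne
    · exact (lower_iff hA).mpr ⟨y, rfl, h3⟩

theorem rel_of_facets (hA : IsTriangulation A) {F σ τ : Finset (ZMod m)} (hσ : σ ∈ Δ)
    (hτ : τ ∈ Δ) (h1 : IsUpperFacetOf A F σ) (h2 : IsLowerFacetOf A F τ) :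
    StackRelOn A Δ σ τ := by
  have h1' := h1
  have h2' := h2
  obtain ⟨x, rfl, hx⟩ := (upper_iff hA).mp h1
  obtain ⟨y, rfl, hy⟩ := (lower_iff hA).mp h2
  have hxy : x ≠ y := by rintro rfl; exact not_up_dn hA hx hy
  have e : insert x F ∩ insert y F = F := by
    ext z
    simp only [Finset.mem_inter, Finset.mem_insert]
    constructor
    · rintro ⟨rfl | h, rfl | h'⟩
      · exact absurd rfl hxy
      all_goals assumption
    · exact fun h => ⟨Or.inr h, Or.inr h⟩
  refine ⟨hσ, hτ, ?_, ?_, ?_⟩ <;> rw [e]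
  · exact (up_card hx).2
  · exact h1'
  · exact h2'

theorem exists_pos4 (hm : 4 ≤ m) (hA : IsTriangulation A) {σ : Finset (ZMod m)}
    (h : σ.card = 4) : ∃ a b c d, Cyc4 a b c d ∧ PosCase A a b c d ∧ σ = {a, b, c, d} := by
  obtain ⟨x, hx⟩ : σ.Nonempty := by rw [← Finset.card_pos]; omega
  have hc : (σ.erase x).card = 3 := by rw [Finset.card_erase_of_mem hx]; omega
  obtain ⟨a, b, c, e, h4⟩ := exists_sort3 (Finset.notMem_erase x σ) hc
  have e' : σ = {x, a, b, c} := by rw [← e, Finset.insert_erase hx]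
  rcases pos_or_neg hm hA h4 with hp | hn
  · exact ⟨x, a, b, c, h4, hp, e'⟩
  · refine ⟨a, b, c, x, cyc4_rot h4, (pos_rot hA h4).mpr hn, ?_⟩
    rw [e']; ext; simp; tauto

theorem upper_quad (hA : IsTriangulation A) {a b c d : ZMod m} (h : Cyc4 a b c d)
    (hp : PosCase A a b c d) (F : Finset (ZMod m)) :
    IsUpperFacetOf A F {a, b, c, d} ↔ (F = {a, b, d} ∨ F = {b, c, d}) := by
  constructor
  · intro hF
    have hl : ∀ G, (G = {a, b, c} ∨ G = {a, c, d}) → IsLowerFacetOf A G {a, b, c, d} :=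
      fun G hG => ⟨a, b, c, d, h, rfl, Or.inl ⟨chi_one.mpr hp, hG⟩⟩
    have hnl : ¬ (F = {a, b, c} ∨ F = {a, c, d}) := fun h => not_upper_lower hA hF (hl F h)
    obtain ⟨x, e, hx⟩ := (upper_iff hA).mp hF
    have hF' : F = ({a, b, c, d} : Finset (ZMod m)).erase x := by
      rw [e, Finset.erase_insert (up_card hx).1]
    have hxm : x ∈ ({a, b, c, d} : Finset (ZMod m)) := by rw [e]; simp
    obtain ⟨h1, h2, h3, h4, h5, h6⟩ := cyc4_ne h
    simp only [Finset.mem_insert, Finset.mem_singleton] at hxm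
    rcases hxm with rfl | rfl | rfl | rfl
    · right; rw [hF']; ext z; simp; grind
    · exfalso; apply hnl; right; rw [hF']; ext z; simp; grind
    · left; rw [hF']; ext z; simp; grind
    · exfalso; apply hnl; left; rw [hF']; ext z; simp; grind
  · intro hF
    exact ⟨a, b, c, d, h, rfl, Or.inl ⟨chi_one.mpr hp, hF⟩⟩

theorem lower_quad (hA : IsTriangulation A) {a b c d : ZMod m} (h : Cyc4 a b c d)
    (hp : PosCase A a b c d) (F : Finset (ZMod m)) :
    IsLowerFacetOf A F {a, b, c, d} ↔ (F = {a, b, c} ∨ F = {a, c, d}) := by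
  constructor
  · intro hF
    have hnl : ¬ (F = {a, b, d} ∨ F = {b, c, d}) := fun hh =>
      not_upper_lower hA ((upper_quad hA h hp F).mpr hh) hF
    obtain ⟨x, e, hx⟩ := (lower_iff hA).mp hF
    have hF' : F = ({a, b, c, d} : Finset (ZMod m)).erase x := by
      rw [e, Finset.erase_insert (dn_card hx).1]
    have hxm : x ∈ ({a, b, c, d} : Finset (ZMod m)) := by rw [e]; simp
    obtain ⟨h1, h2, h3, h4, h5, h6⟩ := cyc4_ne h
    simp only [Finset.mem_insert, Finset.mem_singleton] at hxm
    rcases hxm with rfl | rfl | rfl | rfl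
    · exfalso; apply hnl; right; rw [hF']; ext z; simp; grind
    · right; rw [hF']; ext z; simp; grind
    · exfalso; apply hnl; left; rw [hF']; ext z; simp; grind
    · left; rw [hF']; ext z; simp; grind
  · intro hF
    exact ⟨a, b, c, d, h, rfl, Or.inl ⟨chi_one.mpr hp, hF⟩⟩

theorem prop_step {S U Lo u l : Prop} (f1 : u → ¬ l) (f2 : u → ¬ Lo) :
    ((((S ∨ U) ∧ ¬ Lo) ∧ ¬ l) ∨ u) ↔ ((S ∨ (U ∨ u)) ∧ ¬ (Lo ∨ l)) := by
  tauto

/-- The invariant along the flip sequence. -/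
def Inv (A : Set (ZMod m × ZMod m)) (L : List (Finset (ZMod m))) (k : ℕ)
    (B : Set (ZMod m × ZMod m)) : Prop :=
  IsTriangulation B ∧ ∀ F, Tri B F ↔
    ((Tri (shiftOne A) F ∨ ∃ j : Fin L.length, (j : ℕ) < k ∧ IsUpperFacetOf A F (L.get j)) ∧
      ¬ ∃ j : Fin L.length, (j : ℕ) < k ∧ IsLowerFacetOf A F (L.get j))

variable {L : List (Finset (ZMod m))}

theorem inv_lower (hm : 4 ≤ m) (hA : IsTriangulation A) (hΔ : IsMatTriangulation A Δ)
    (hnd : L.Nodup) (htf : L.toFinset = Δ)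
    (hext : ∀ i j : Fin L.length,
      Relation.ReflTransGen (StackRelOn A Δ) (L.get i) (L.get j) → (i : ℕ) ≤ j)
    {B : Set (ZMod m × ZMod m)} (k : Fin L.length) (hB : Inv A L k B) {F : Finset (ZMod m)}
    (hF : IsLowerFacetOf A F (L.get k)) : Tri B F := by
  have hmem : ∀ j, L.get j ∈ Δ := fun j => by rw [← htf]; simp
  rw [hB.2]
  constructor
  · rcases lower_alt hm hA hΔ (hmem k) hF with h | ⟨τ, hτ, hu⟩
    · exact Or.inl h
    · right
      rw [← htf, List.mem_toFinset] at hτ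
      obtain ⟨j, rfl⟩ := List.mem_iff_get.mp hτ
      have hle := hext j k (Relation.ReflTransGen.single
        (rel_of_facets hA (hmem j) (hmem k) hu hF))
      have hne : (j : ℕ) ≠ k := by
        intro h
        have := Fin.ext h
        subst this
        exact not_upper_lower hA hu hF
      exact ⟨j, by omega, hu⟩
  · rintro ⟨j, hj, hl⟩
    have := lower_unique hm hA hΔ (hmem j) (hmem k) hl hF
    have := (List.Nodup.get_inj_iff hnd).mp this
    subst this
    omega

theorem inv_step (hm : 4 ≤ m) (hA : IsTriangulation A) (hΔ : IsMatTriangulation A Δ)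
    (hnd : L.Nodup) (htf : L.toFinset = Δ)
    (hext : ∀ i j : Fin L.length,
      Relation.ReflTransGen (StackRelOn A Δ) (L.get i) (L.get j) → (i : ℕ) ≤ j)
    {B : Set (ZMod m × ZMod m)} (k : Fin L.length) (hB : Inv A L k B) :
    ∃ B', IncFlip A (L.get k) B B' ∧ Inv A L (k + 1) B' := by
  have hmem : ∀ j, L.get j ∈ Δ := fun j => by rw [← htf]; simp
  obtain ⟨a, b, c, d, h4, hp, e⟩ := exists_pos4 hm hA (hΔ.2.1 _ (hmem k))
  have hl := fun F => inv_lower (F := F) hm hA hΔ hnd htf hext k hB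
  have t1 : Tri B {a, b, c} := hl _ (by rw [e, lower_quad hA h4 hp]; exact Or.inl rfl)
  have t2 : Tri B {a, c, d} := hl _ (by rw [e, lower_quad hA h4 hp]; exact Or.inr rfl)
  obtain ⟨h1, h2, h3, h5, h6, h7⟩ := cyc4_ne h4
  have q : Quad B a b c d := ⟨h4, t1.2 a (by simp) b (by simp) h1,
    t1.2 b (by simp) c (by simp) h5, t2.2 c (by simp) d (by simp) h7,
    t2.2 d (by simp) a (by simp) h3.symm⟩
  have hac : (a, c) ∈ B := mem_of_edge hm h4 (t1.2 a (by simp) c (by simp) h2)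
  refine ⟨flipSet B a b c d, ⟨a, b, c, d, h4, e, q.ab, q.bc, q.cd, q.da,
    Or.inl ⟨chi_one.mpr hp, hac, rfl⟩⟩, flip_triangulation hm hB.1 q hac, ?_⟩
  intro F
  rw [flip_tri hm hB.1 q hac, ← upper_quad hA h4 hp, ← lower_quad hA h4 hp, ← e, hB.2]
  have hU : ∀ P : Finset (ZMod m) → Prop,
      (∃ j : Fin L.length, (j : ℕ) < k + 1 ∧ P (L.get j)) ↔
      (∃ j : Fin L.length, (j : ℕ) < k ∧ P (L.get j)) ∨ P (L.get k) := by
    intro P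
    constructor
    · rintro ⟨j, hj, hP⟩
      by_cases hjk : (j : ℕ) = k
      · have := Fin.ext hjk
        subst this
        exact Or.inr hP
      · exact Or.inl ⟨j, by omega, hP⟩
    · rintro (⟨j, hj, hP⟩ | hP)
      · exact ⟨j, by omega, hP⟩
      · exact ⟨k, by omega, hP⟩
  rw [hU (fun τ => IsUpperFacetOf A F τ), hU (fun τ => IsLowerFacetOf A F τ)]
  have f1 : IsUpperFacetOf A F (L.get k) → ¬ IsLowerFacetOf A F (L.get k) :=
    fun h h' => not_upper_lower hA h h'
  have f2 : IsUpperFacetOf A F (L.get k) →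
      ¬ ∃ j : Fin L.length, (j : ℕ) < k ∧ IsLowerFacetOf A F (L.get j) := by
    rintro h ⟨j, hj, h'⟩
    have := hext k j (Relation.ReflTransGen.single
        (rel_of_facets hA (hmem k) (hmem j) h h'))
    omega
  exact prop_step f1 f2

theorem inv_zero (hA : IsTriangulation A) : Inv A L 0 (shiftOne A) := by
  refine ⟨shift_tri hA, fun F => ?_⟩
  simp

theorem inv_last (hm : 4 ≤ m) (hA : IsTriangulation A) (hΔ : IsMatTriangulation A Δ)
    (hnd : L.Nodup) (htf : L.toFinset = Δ)
    (hext : ∀ i j : Fin L.length,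
      Relation.ReflTransGen (StackRelOn A Δ) (L.get i) (L.get j) → (i : ℕ) ≤ j)
    {B : Set (ZMod m × ZMod m)} (hB : Inv A L L.length B) : B = A := by
  have hmem : ∀ j, L.get j ∈ Δ := fun j => by rw [← htf]; simp
  have hT : ∀ F, Tri B F → Tri A F ∨ Tri (shiftOne A) F := by
    intro F hF
    obtain ⟨h1, h2⟩ := (hB.2 F).mp hF
    rcases h1 with h1 | ⟨j, -, hj⟩
    · exact Or.inr h1
    · rcases upper_alt hm hA hΔ (hmem j) hj with h | ⟨τ, hτ, hl⟩
      · exact Or.inl h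
      · rw [← htf, List.mem_toFinset] at hτ
        obtain ⟨i, rfl⟩ := List.mem_iff_get.mp hτ
        exact absurd ⟨i, i.2, hl⟩ h2
  rcases final_eq hm hA hB.1 hT with h | h
  · exact h
  · exfalso
    obtain ⟨τ, hτ⟩ := hΔ.1
    rw [← htf, List.mem_toFinset] at hτ
    have hlen : 0 < L.length := List.length_pos_of_mem hτ
    let k : Fin L.length := ⟨0, hlen⟩
    obtain ⟨a, b, c, d, h4, hp, e⟩ := exists_pos4 hm hA (hΔ.2.1 _ (hmem k))
    have hlow : IsLowerFacetOf A {a, b, c} (L.get k) := by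
      rw [e, lower_quad hA h4 hp]; exact Or.inl rfl
    have ht := inv_lower hm hA hΔ hnd htf hext k (inv_zero hA) hlow
    rw [← h] at ht
    exact ((hB.2 _).mp ht).2 ⟨k, hlen, hlow⟩

end Main
end CyclicTri

open CyclicTri in
/-- If `Δ` is a stackable triangulation of `M_T` and `σ₁ < ⋯ < σ_l` a linear extension
of the stacking order `⇝`, then there are polygon triangulations `T₀, …, T_l` with
`T₀ = T + 1`, each `T_i` the increasing flip of `T_{i-1}` given by `σ_i`, and
`T_l = T`. -/
theorem stmt_17 (m : ℕ) (hm : 4 ≤ m) (A : Set (ZMod m × ZMod m))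
    (hT : IsTriangulation A) (Δ : Finset (Finset (ZMod m)))
    (hΔ : IsMatTriangulation A Δ)
    (hstack : ∀ σ ∈ Δ, ∀ τ ∈ Δ, Relation.ReflTransGen (StackRelOn A Δ) σ τ →
      Relation.ReflTransGen (StackRelOn A Δ) τ σ → σ = τ)
    (L : List (Finset (ZMod m))) (hnd : L.Nodup) (htf : L.toFinset = Δ)
    (hext : ∀ i j : Fin L.length,
      Relation.ReflTransGen (StackRelOn A Δ) (L.get i) (L.get j) → (i : ℕ) ≤ j) :
    ∃ Ts : Fin (L.length + 1) → Set (ZMod m × ZMod m),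
      Ts 0 = shiftOne A ∧ Ts (Fin.last L.length) = A ∧
      (∀ i, IsTriangulation (Ts i)) ∧
      (∀ i : Fin L.length, IncFlip A (L.get i) (Ts i.castSucc) (Ts i.succ)) := by
  have : NeZero m := ⟨by omega⟩
  classical
  choose! f hf using fun (k : Fin L.length) (B : Set (ZMod m × ZMod m)) (h : Inv A L k B) =>
    inv_step hm hT hΔ hnd htf hext k h
  let g : ℕ → Set (ZMod m × ZMod m) := fun n =>
    Nat.rec (shiftOne A) (fun k B => if h : k < L.length then f ⟨k, h⟩ B else B) n
  have gs : ∀ k (h : k < L.length), g (k + 1) = f ⟨k, h⟩ (g k) := fun k h => dif_pos h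
  have hinv : ∀ k, k ≤ L.length → Inv A L k (g k) := by
    intro k
    induction k with
    | zero => intro _; exact inv_zero hT
    | succ k ih =>
      intro hk
      rw [gs k (by omega)]
      exact (hf ⟨k, by omega⟩ (g k) (ih (by omega))).2
  refine ⟨fun i => g i, rfl, ?_, fun i => (hinv i (by omega)).1, ?_⟩
  · exact inv_last hm hT hΔ hnd htf hext (hinv L.length le_rfl)
  · intro i
    show IncFlip A (L.get i) (g i) (g (i + 1))
    rw [gs i i.2]
    exact (hf i (g i) (hinv i (by omega))).1
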